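/- arXiv:2202.03500 — 8 statements merged into one kernel-verified Lean document; each statement's English description precedes it below -/
import Mathlib

section
/- Let f : B → A be a surjective homomorphism of finite groups and let e ≥ 1 be an integer such that B can be generated by e elements. Then for every e-tuple h̄ = (h₁,…,h_e) ∈ A^e which generates A, the set {ḡ ∈ B^e : f(ḡ) = h̄ and ḡ generates B} is non-empty; moreover its cardinality is the same for all generating e-tuples h̄ of A. -/
/-- The tuples with entries in `C` lying over `h` are in bijection with those lying over `h'`, by
translation, when `C` surjects onto the target. -/
theorem card_lifts_in_subgroup_eq {A B ι : Type*} [Group A] [Group B] (f : B →* A)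
    {C : Subgroup B} (hC : C.map f = ⊤) (h h' : ι → A) :
    Nat.card {g : ι → B // f ∘ g = h ∧ Subgroup.closure (Set.range g) ≤ C} =
      Nat.card {g : ι → B // f ∘ g = h' ∧ Subgroup.closure (Set.range g) ≤ C} := by
  have lift (i : ι) : ∃ t ∈ C, f t = (h i)⁻¹ * h' i :=
    Subgroup.mem_map.1 (hC ▸ Subgroup.mem_top _)
  choose t ht hft using lift
  refine Nat.card_congr ((Equiv.mulRight t).subtypeEquiv fun g => ?_)
  simp only [Subgroup.closure_le, Set.range_subset_iff, SetLike.mem_coe, funext_iff,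
    Function.comp_apply, Equiv.coe_mulRight, Pi.mul_apply, map_mul, hft]
  refine and_congr (forall_congr' fun i => ?_)
    (forall_congr' fun i => (C.mul_mem_cancel_right (ht i)).symm)
  rw [← mul_assoc, mul_eq_right, mul_inv_eq_one]

open Classical in
/-- Tuples over `h` with entries in `C` are sorted by the subgroup they generate. -/
theorem card_lifts_in_subgroup_eq_add_sum {A B ι : Type*} [Group A] [Group B] [Finite ι] [Finite B]
    [Fintype (Subgroup B)] (f : B →* A) (C : Subgroup B) (h : ι → A) :
    Nat.card {g : ι → B // f ∘ g = h ∧ Subgroup.closure (Set.range g) ≤ C} =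
      Nat.card {g : ι → B // f ∘ g = h ∧ Subgroup.closure (Set.range g) = C} +
        ∑ D : Subgroup B with D < C,
          Nat.card {g : ι → B // f ∘ g = h ∧ Subgroup.closure (Set.range g) = D} := by
  have := Fintype.ofFinite B
  have := Fintype.ofFinite ι
  simp only [Nat.card_eq_fintype_card, Fintype.card_subtype]
  have hle : (Finset.univ.filter fun D : Subgroup B => D ≤ C) =
      insert C (Finset.univ.filter fun D => D < C) := by
    ext D
    simp [le_iff_eq_or_lt]
  rw [← Finset.sum_insert (a := C)
    (f := fun D => (Finset.univ.filter fun g : ι → B =>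
      f ∘ g = h ∧ Subgroup.closure (Set.range g) = D).card) (by simp), ← hle, Finset.card_eq_sum_card_fiberwise
    (f := fun g : ι → B => Subgroup.closure (Set.range g))
    (t := Finset.univ.filter fun D => D ≤ C) (by intro g; simp)]
  refine Finset.sum_congr rfl fun D hD => congrArg Finset.card ?_
  ext g
  simp only [Finset.mem_filter, Finset.mem_univ, true_and] at hD ⊢
  exact ⟨fun hg => ⟨hg.1.1, hg.2⟩, fun hg => ⟨⟨hg.1, hg.2.trans_le hD⟩, hg.2⟩⟩

/-- The number of lifts of a generating tuple that generate a given subgroup does not depend on the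
tuple. -/
theorem card_lifts_generating_eq {A B ι : Type*} [Group A] [Group B] [Finite ι] [Finite B]
    (f : B →* A) {h h' : ι → A} (hh : Subgroup.closure (Set.range h) = ⊤)
    (hh' : Subgroup.closure (Set.range h') = ⊤) (C : Subgroup B) :
    Nat.card {g : ι → B // f ∘ g = h ∧ Subgroup.closure (Set.range g) = C} =
      Nat.card {g : ι → B // f ∘ g = h' ∧ Subgroup.closure (Set.range g) = C} := by
  classical
  have := Fintype.ofFinite (Subgroup B)
  induction C using WellFoundedLT.induction with
  | ind C ih =>
    by_cases hC : C.map f = ⊤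
    · have key := card_lifts_in_subgroup_eq f hC h h'
      rw [card_lifts_in_subgroup_eq_add_sum, card_lifts_in_subgroup_eq_add_sum,
        Finset.sum_congr rfl fun D hD => ih D (Finset.mem_filter.1 hD).2] at key
      exact Nat.add_right_cancel key
    · have empty {k : ι → A} (hk : Subgroup.closure (Set.range k) = ⊤) :
          IsEmpty {g : ι → B // f ∘ g = k ∧ Subgroup.closure (Set.range g) = C} := by
        refine ⟨fun ⟨g, hg, hgC⟩ => hC ?_⟩
        rw [← hgC, MonoidHom.map_closure, ← Set.range_comp, hg, hk]
      have := empty hh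
      have := empty hh'
      simp only [Nat.card_of_isEmpty]


/-- **Gaschütz's Lemma** (the key ingredient, Lemma 17.7.1 of Fried–Jarden):
if `f : B → A` is a surjective homomorphism of finite groups and `B` can be
generated by `e` elements, then every generating `e`-tuple of `A` lifts to a
generating `e`-tuple of `B`, and the number of such generating lifts does not
depend on the chosen generating `e`-tuple of `A`. -/
theorem stmt_0 {A B : Type*} [Group A] [Group B] [Finite A] [Finite B]
    (f : B →* A) (hf : Function.Surjective f)
    (e : ℕ) (he : 1 ≤ e)
    (hB : ∃ g : Fin e → B, Subgroup.closure (Set.range g) = ⊤) :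
    (∀ h : Fin e → A, Subgroup.closure (Set.range h) = ⊤ →
        {g : Fin e → B | (fun i => f (g i)) = h ∧
          Subgroup.closure (Set.range g) = ⊤}.Nonempty)
    ∧
    (∀ h₁ h₂ : Fin e → A, Subgroup.closure (Set.range h₁) = ⊤ →
        Subgroup.closure (Set.range h₂) = ⊤ →
        Nat.card {g : Fin e → B //
            (fun i => f (g i)) = h₁ ∧ Subgroup.closure (Set.range g) = ⊤}
          = Nat.card {g : Fin e → B //
            (fun i => f (g i)) = h₂ ∧ Subgroup.closure (Set.range g) = ⊤}) := by
  have card_eq (h₁ h₂ : Fin e → A) (hh₁ : Subgroup.closure (Set.range h₁) = ⊤)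
      (hh₂ : Subgroup.closure (Set.range h₂) = ⊤) :=
    card_lifts_generating_eq f hh₁ hh₂ ⊤
  refine ⟨fun h hh => ?_, card_eq⟩
  obtain ⟨g, hg⟩ := hB
  have hfg : Subgroup.closure (Set.range (f ∘ g)) = ⊤ := by
    rw [Set.range_comp, ← MonoidHom.map_closure, hg, Subgroup.map_top_of_surjective f hf]
  have : Nonempty {g' : Fin e → B // f ∘ g' = f ∘ g ∧ Subgroup.closure (Set.range g') = ⊤} :=
    ⟨⟨g, rfl, hg⟩⟩
  have pos := Nat.card_pos.trans_eq (card_eq (f ∘ g) h hfg hh)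
  obtain ⟨g', hg'⟩ := (Nat.card_pos_iff.1 pos).1
  exact ⟨g', hg'⟩
end

section
/- Let f : B → A be a surjective homomorphism of finite groups and let e ≥ 1 be an integer such that B can be generated by e elements. Then for every e-tuple h̄ ∈ A^e which generates A, the number of e-tuples of B that generate B equals the number of e-tuples of A that generate A multiplied by the cardinality of {ḡ ∈ B^e : f(ḡ) = h̄ and ḡ generates B}. -/
open Classical in
/-- The tuples lifting `h` along `f` with entries in `C`, counted by the subgroup they generate. -/
theorem card_lifts_mem_eq_sum {A B ι : Type*} [Group A] [Group B] [Fintype B] [Fintype ι]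
    (f : B →* A) (C : Subgroup B) (h : ι → A) :
    (Finset.univ.filter fun g : ι → B => f ∘ g = h ∧ ∀ i, g i ∈ C).card
      = ∑ D : Subgroup B with D ≤ C, (Finset.univ.filter fun g : ι → B =>
          f ∘ g = h ∧ Subgroup.closure (Set.range g) = D).card := by
  rw [Finset.card_eq_sum_card_fiberwise (f := fun g => Subgroup.closure (Set.range g))
    (t := Finset.univ.filter fun D : Subgroup B => D ≤ C)]
  · refine Finset.sum_congr rfl fun D hD => ?_
    congr 1
    ext g
    simp only [Finset.mem_filter, Finset.mem_univ, true_and] at hD ⊢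
    refine ⟨fun H => ⟨H.1.1, H.2⟩, fun H => ⟨⟨H.1, fun i => hD ?_⟩, H.2⟩⟩
    rw [← H.2]
    exact Subgroup.subset_closure (Set.mem_range_self i)
  · intro g hg
    simp only [Finset.coe_filter, Finset.mem_univ, true_and, Set.mem_ofPred_eq] at hg ⊢
    rw [Subgroup.closure_le]
    rintro _ ⟨i, rfl⟩
    exact hg.2 i

open Classical in
/-- If `C` maps onto `A`, all tuples of `A` have the same number of lifts with entries in `C`. -/
theorem card_lifts_mem_eq {A B ι : Type*} [Group A] [Group B] [Fintype B] [Fintype ι]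
    (f : B →* A) (C : Subgroup B) (hC : C.map f = ⊤) (h k : ι → A) :
    (Finset.univ.filter fun g : ι → B => f ∘ g = h ∧ ∀ i, g i ∈ C).card
      = (Finset.univ.filter fun g : ι → B => f ∘ g = k ∧ ∀ i, g i ∈ C).card := by
  have hc : ∀ i, ∃ c ∈ C, f c = k i * (h i)⁻¹ := fun i =>
    Subgroup.mem_map.mp (hC ▸ Subgroup.mem_top _)
  choose c hcC hcf using hc
  refine Finset.card_equiv (Equiv.mulLeft c) fun g => ?_
  simp only [Finset.mem_filter, Finset.mem_univ, true_and, Equiv.coe_mulLeft, funext_iff,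
    Function.comp_apply, Pi.mul_apply, map_mul, hcf, C.mul_mem_cancel_left (hcC _)]
  refine and_congr_left fun _ => forall_congr' fun i => ?_
  rw [mul_assoc, mul_eq_left, inv_mul_eq_one, eq_comm]

open Classical in
/-- Gaschütz's lemma: the number of lifts of a generating tuple of `A` that generate a given
subgroup `C` does not depend on the tuple. -/
theorem card_lifts_closure_eq {A B ι : Type*} [Group A] [Group B] [Fintype B] [Fintype ι]
    (f : B →* A) {h k : ι → A} (hh : Subgroup.closure (Set.range h) = ⊤)
    (hk : Subgroup.closure (Set.range k) = ⊤) (C : Subgroup B) :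
    (Finset.univ.filter fun g : ι → B => f ∘ g = h ∧ Subgroup.closure (Set.range g) = C).card
      = (Finset.univ.filter fun g : ι → B =>
          f ∘ g = k ∧ Subgroup.closure (Set.range g) = C).card := by
  induction C using WellFoundedLT.induction with
  | ind C ih =>
  by_cases hC : C.map f = ⊤
  · have key := card_lifts_mem_eq f C hC h k
    have hmem : C ∈ Finset.univ.filter fun D : Subgroup B => D ≤ C := by simp
    rw [card_lifts_mem_eq_sum, card_lifts_mem_eq_sum, ← Finset.add_sum_erase _ _ hmem,
      ← Finset.add_sum_erase (Finset.univ.filter fun D : Subgroup B => D ≤ C)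
        (fun D => (Finset.univ.filter fun g : ι → B =>
          f ∘ g = k ∧ Subgroup.closure (Set.range g) = D).card) hmem] at key
    have rest := Finset.sum_congr (s₁ := (Finset.univ.filter fun D : Subgroup B => D ≤ C).erase C)
      rfl fun D hD => ih D <| lt_of_le_of_ne
        (Finset.mem_filter.mp (Finset.mem_of_mem_erase hD)).2 (Finset.ne_of_mem_erase hD)
    rw [rest] at key
    exact Nat.add_right_cancel key
  · have empty : ∀ l : ι → A, Subgroup.closure (Set.range l) = ⊤ →
        (Finset.univ.filter fun g : ι → B =>
          f ∘ g = l ∧ Subgroup.closure (Set.range g) = C) = ∅ := by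
      intro l hl
      refine Finset.filter_eq_empty_iff.mpr fun g _ ⟨hg, hgC⟩ => hC ?_
      rw [← hgC, MonoidHom.map_closure, ← Set.range_comp, hg, hl]
    rw [empty h hh, empty k hk]

/-- If `f : B → A` is a surjective homomorphism of finite groups, `e ≥ 1`, and `B`
can be generated by `e` elements, then for every generating `e`-tuple `h` of `A`,
the number of generating `e`-tuples of `B` equals the number of generating
`e`-tuples of `A` times the number of generating `e`-tuples of `B` lifting `h`. -/
theorem stmt_1 {A B : Type*} [Group A] [Group B] [Finite A] [Finite B]
    (f : B →* A) (hf : Function.Surjective f)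
    (e : ℕ) (he : 1 ≤ e)
    (hB : ∃ g : Fin e → B, Subgroup.closure (Set.range g) = ⊤)
    (h : Fin e → A) (hh : Subgroup.closure (Set.range h) = ⊤) :
    Nat.card {g : Fin e → B // Subgroup.closure (Set.range g) = ⊤}
      = Nat.card {a : Fin e → A // Subgroup.closure (Set.range a) = ⊤} *
        Nat.card {g : Fin e → B //
          (fun i => f (g i)) = h ∧ Subgroup.closure (Set.range g) = ⊤} := by
  classical
  have := Fintype.ofFinite A
  have := Fintype.ofFinite B
  simp only [Nat.card_eq_fintype_card, Fintype.card_subtype]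
  rw [Finset.card_eq_sum_card_fiberwise (f := fun g => f ∘ g)
    (t := Finset.univ.filter fun a : Fin e → A => Subgroup.closure (Set.range a) = ⊤),
    ← smul_eq_mul, ← Finset.sum_const]
  · refine Finset.sum_congr rfl fun a ha => ?_
    rw [Finset.filter_filter]
    simp only [and_comm (a := Subgroup.closure _ = ⊤)]
    convert card_lifts_closure_eq f (Finset.mem_filter.mp ha).2 hh ⊤
    rfl
  · intro g hg
    simp only [Finset.coe_filter, Finset.mem_univ, true_and, Set.mem_ofPred_eq] at hg ⊢
    rw [Set.range_comp, ← MonoidHom.map_closure, hg, Subgroup.map_top_of_surjective f hf]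
end

section
/- Let G be a finite group, e ≥ 1 an integer, and A, B normal subgroups of G such that the quotient G/B can be generated by e elements; let AB denote the product subgroup. Then for every x̄ = (x₁,…,x_e) ∈ (G/A)^e, the set T(x̄) = {ḡ ∈ G^e : the image of ḡ in (G/A)^e equals x̄, and the image of ḡ in (G/B)^e generates G/B} has cardinality |A ∩ B|^e · |{ȳ ∈ (G/B)^e : ȳ generates G/B and the image of ȳ in (G/AB)^e equals the image of x̄ in (G/AB)^e}|. In particular, if the image of x̄ in G/AB generates G/AB, then |T(x̄)| is non-zero and is the same for all such x̄. -/
section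

variable {G : Type*} [Group G] (A B : Subgroup G) [A.Normal] [B.Normal]

/-- The canonical map `G/A → G/(AB)` (coordinatewise images are taken with this map). -/
noncomputable def quotAtoAB : G ⧸ A →* G ⧸ (A ⊔ B) :=
  QuotientGroup.map A (A ⊔ B) (MonoidHom.id G) (by simp)

/-- The canonical map `G/B → G/(AB)`. -/
noncomputable def quotBtoAB : G ⧸ B →* G ⧸ (A ⊔ B) :=
  QuotientGroup.map B (A ⊔ B) (MonoidHom.id G) (by simp)

end

section Gaschutz

variable {ι H Q : Type*} [Group H] [Group Q]

/-- Coordinatewise left translation moves the lifts of `q₁` with entries in `K` to those of `q₂`. -/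
theorem card_lifts_le_eq (f : H →* Q) {q₁ q₂ : ι → Q}
    (h₁ : Subgroup.closure (Set.range q₁) = ⊤) (h₂ : Subgroup.closure (Set.range q₂) = ⊤)
    (K : Subgroup H) :
    Nat.card {y : ι → H // Subgroup.closure (Set.range y) ≤ K ∧ (fun i => f (y i)) = q₁} =
      Nat.card {y : ι → H // Subgroup.closure (Set.range y) ≤ K ∧ (fun i => f (y i)) = q₂} := by
  by_cases hK : K.map f = ⊤
  · have hex (i : ι) : ∃ k ∈ K, f k = q₂ i * (q₁ i)⁻¹ := by
      rw [← Subgroup.mem_map, hK]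
      exact Subgroup.mem_top _
    choose k hkK hk using hex
    refine Nat.card_congr ((Equiv.mulLeft k).subtypeEquiv fun y => ?_)
    simp only [Subgroup.closure_le, Set.range_subset_iff, SetLike.mem_coe, funext_iff,
      Equiv.coe_mulLeft, Pi.mul_apply, map_mul, hk]
    refine and_congr (forall_congr' fun i => (K.mul_mem_cancel_left (hkK i)).symm)
      (forall_congr' fun i => ?_)
    rw [mul_assoc, mul_eq_left, inv_mul_eq_one, eq_comm]
  · have hempty {q : ι → Q} (hq : Subgroup.closure (Set.range q) = ⊤) :
        IsEmpty {y : ι → H // Subgroup.closure (Set.range y) ≤ K ∧ (fun i => f (y i)) = q} := by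
      refine ⟨fun ⟨y, hy, hyq⟩ => hK (top_le_iff.mp ?_)⟩
      rw [← hq, Subgroup.closure_le]
      rintro _ ⟨i, rfl⟩
      exact ⟨y i, hy (Subgroup.subset_closure ⟨i, rfl⟩), congrFun hyq i⟩
    have := hempty h₁
    have := hempty h₂
    rw [Nat.card_of_isEmpty, Nat.card_of_isEmpty]

open Classical in
/-- The lifts with entries in `K`, sorted by the subgroup they generate. -/
theorem card_lifts_le_eq_sum [Finite ι] [Finite H] [Fintype (Subgroup H)] (f : H →* Q)
    (q : ι → Q) (K : Subgroup H) :
    Nat.card {y : ι → H // Subgroup.closure (Set.range y) ≤ K ∧ (fun i => f (y i)) = q} =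
      ∑ L : Subgroup H with L ≤ K,
        Nat.card {y : ι → H // Subgroup.closure (Set.range y) = L ∧ (fun i => f (y i)) = q} := by
  have := Fintype.ofFinite (ι → H)
  simp only [Nat.card_eq_fintype_card, Fintype.card_subtype]
  rw [Finset.card_eq_sum_card_fiberwise (f := fun y => Subgroup.closure (Set.range y))
    (t := {L : Subgroup H | L ≤ K})]
  · refine Finset.sum_congr rfl fun L hL => congrArg _ ?_
    ext y
    simp only [Finset.mem_filter, Finset.mem_univ, true_and] at hL ⊢
    grind
  · intro y hy
    simp_all

/-- **Gaschütz's lemma**, counting form: the number of lifts of a generating tuple of `Q` that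
generate a given subgroup of `H` does not depend on the generating tuple. -/
theorem card_generating_lifts_eq [Finite ι] [Finite H] (f : H →* Q) {q₁ q₂ : ι → Q}
    (h₁ : Subgroup.closure (Set.range q₁) = ⊤) (h₂ : Subgroup.closure (Set.range q₂) = ⊤)
    (K : Subgroup H) :
    Nat.card {y : ι → H // Subgroup.closure (Set.range y) = K ∧ (fun i => f (y i)) = q₁} =
      Nat.card {y : ι → H // Subgroup.closure (Set.range y) = K ∧ (fun i => f (y i)) = q₂} := by
  classical
  have := Fintype.ofFinite (Subgroup H)
  induction K using WellFoundedLT.induction with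
  | ind K ih =>
    have htotal := card_lifts_le_eq f h₁ h₂ K
    have hmem : K ∈ ({L | L ≤ K} : Finset (Subgroup H)) := by simp
    rw [card_lifts_le_eq_sum, card_lifts_le_eq_sum, ← Finset.add_sum_erase _ _ hmem,
      ← Finset.add_sum_erase _ _ hmem] at htotal
    rw [Finset.sum_congr rfl fun L hL => ih L ?_] at htotal
    · exact Nat.add_right_cancel htotal
    · simp only [Finset.mem_erase, Finset.mem_filter, Finset.mem_univ, true_and] at hL
      exact lt_of_le_of_ne hL.2 hL.1

end Gaschutz

section Quotients

variable {G : Type*} [Group G] (A B : Subgroup G) [A.Normal] [B.Normal]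

theorem quotAtoAB_mk (g : G) : quotAtoAB A B (g : G ⧸ A) = (g : G ⧸ (A ⊔ B)) := rfl

theorem quotBtoAB_mk (g : G) : quotBtoAB A B (g : G ⧸ B) = (g : G ⧸ (A ⊔ B)) := rfl

theorem quotBtoAB_surjective : Function.Surjective (quotBtoAB A B) := by
  intro z
  obtain ⟨g, rfl⟩ := QuotientGroup.mk_surjective z
  exact ⟨g, quotBtoAB_mk A B g⟩

variable {A B} in
theorem exists_common_lift {x : G ⧸ A} {y : G ⧸ B} (h : quotBtoAB A B y = quotAtoAB A B x) :
    ∃ g : G, (g : G ⧸ A) = x ∧ (g : G ⧸ B) = y := by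
  obtain ⟨a, rfl⟩ := QuotientGroup.mk_surjective x
  obtain ⟨b, rfl⟩ := QuotientGroup.mk_surjective y
  rw [quotAtoAB_mk, quotBtoAB_mk, eq_comm, QuotientGroup.eq, Subgroup.mem_sup_of_normal_left] at h
  obtain ⟨α, hα, β, hβ, hab⟩ := h
  refine ⟨a * α, (QuotientGroup.eq.mpr ?_).symm, (QuotientGroup.eq.mpr ?_)⟩
  · simpa using hα
  · have : (a * α)⁻¹ * b = β := by rw [mul_inv_rev, mul_assoc, ← hab, inv_mul_cancel_left]
    rwa [this]

/-- Lifts of `x` along `G → G ⧸ A` whose image in `G ⧸ B` satisfies `P`, counted through that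
image. -/
theorem card_lifts_eq_pow_mul {ι : Type*} [Finite ι] (P : (ι → G ⧸ B) → Prop) (x : ι → G ⧸ A) :
    Nat.card {g : ι → G // (fun i => (g i : G ⧸ A)) = x ∧ P fun i => (g i : G ⧸ B)} =
      Nat.card (A ⊓ B : Subgroup G) ^ Nat.card ι *
        Nat.card {y : ι → G ⧸ B //
          P y ∧ (fun i => quotBtoAB A B (y i)) = fun i => quotAtoAB A B (x i)} := by
  have hlift (y : {y : ι → G ⧸ B //
      P y ∧ (fun i => quotBtoAB A B (y i)) = fun i => quotAtoAB A B (x i)}) (i : ι) :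
      ∃ g : G, (g : G ⧸ A) = x i ∧ (g : G ⧸ B) = y.1 i :=
    exists_common_lift (congrFun y.2.2 i)
  choose s hsA hsB using hlift
  rw [← Nat.card_fun, ← Nat.card_prod, eq_comm]
  refine Nat.card_congr (Equiv.ofBijective (fun p => ⟨fun i => s p.2 i * p.1 i, ?_, ?_⟩) ⟨?_, ?_⟩)
  · funext i
    rw [QuotientGroup.mk_mul_of_mem _ (p.1 i).2.1, hsA]
  · simp_rw [QuotientGroup.mk_mul_of_mem _ (p.1 _).2.2, hsB]
    exact p.2.2.1
  · rintro ⟨c, y⟩ ⟨c', y'⟩ h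
    have h (i : ι) : s y i * c i = s y' i * c' i := congrFun (congrArg Subtype.val h) i
    obtain rfl : y = y' := by
      ext i
      rw [← hsB, ← hsB, ← QuotientGroup.mk_mul_of_mem _ (c i).2.2, h,
        QuotientGroup.mk_mul_of_mem _ (c' i).2.2]
    obtain rfl : c = c' := by
      ext i
      exact mul_left_cancel (h i)
    rfl
  · rintro ⟨g, hgA, hgB⟩
    let y : {y : ι → G ⧸ B //
        P y ∧ (fun i => quotBtoAB A B (y i)) = fun i => quotAtoAB A B (x i)} :=
      ⟨fun i => g i, hgB, by subst hgA; rfl⟩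
    refine ⟨⟨fun i => ⟨(s y i)⁻¹ * g i, ?_, ?_⟩, y⟩, ?_⟩
    · exact QuotientGroup.eq.mp ((hsA y i).trans (congrFun hgA i).symm)
    · exact QuotientGroup.eq.mp (hsB y i)
    · ext i
      exact mul_inv_cancel_left _ _

end Quotients


/-- Let `G` be a finite group, `e ≥ 1`, and `A`, `B` normal subgroups of `G` with `G/B`
generated by `e` elements.  For `x : Fin e → G ⧸ A`, the set
`T(x) = {g ∈ G^e : g mod A = x and g mod B generates G/B}` has cardinality
`|A ∩ B|^e · |{y ∈ (G/B)^e : y generates G/B and y mod AB = x mod AB}|`;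
in particular, if `x mod AB` generates `G/(AB)` then `|T(x)|` is non-zero and is
the same for all such `x`. -/
theorem stmt_2 {G : Type*} [Group G] [Finite G]
    (e : ℕ) (he : 1 ≤ e)
    (A B : Subgroup G) [A.Normal] [B.Normal]
    (hgen : ∃ y : Fin e → G ⧸ B, Subgroup.closure (Set.range y) = ⊤) :
    (∀ x : Fin e → G ⧸ A,
      Nat.card {g : Fin e → G //
          (fun i => (QuotientGroup.mk (g i) : G ⧸ A)) = x ∧
          Subgroup.closure (Set.range fun i => (QuotientGroup.mk (g i) : G ⧸ B)) = ⊤}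
        = Nat.card (A ⊓ B : Subgroup G) ^ e *
          Nat.card {y : Fin e → G ⧸ B //
            Subgroup.closure (Set.range y) = ⊤ ∧
            (fun i => quotBtoAB A B (y i)) = fun i => quotAtoAB A B (x i)})
    ∧
    (∀ x : Fin e → G ⧸ A,
      Subgroup.closure (Set.range fun i => quotAtoAB A B (x i)) = ⊤ →
      Nat.card {g : Fin e → G //
          (fun i => (QuotientGroup.mk (g i) : G ⧸ A)) = x ∧
          Subgroup.closure (Set.range fun i => (QuotientGroup.mk (g i) : G ⧸ B)) = ⊤} ≠ 0)
    ∧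
    (∀ x₁ x₂ : Fin e → G ⧸ A,
      Subgroup.closure (Set.range fun i => quotAtoAB A B (x₁ i)) = ⊤ →
      Subgroup.closure (Set.range fun i => quotAtoAB A B (x₂ i)) = ⊤ →
      Nat.card {g : Fin e → G //
          (fun i => (QuotientGroup.mk (g i) : G ⧸ A)) = x₁ ∧
          Subgroup.closure (Set.range fun i => (QuotientGroup.mk (g i) : G ⧸ B)) = ⊤}
        = Nat.card {g : Fin e → G //
          (fun i => (QuotientGroup.mk (g i) : G ⧸ A)) = x₂ ∧
          Subgroup.closure (Set.range fun i => (QuotientGroup.mk (g i) : G ⧸ B)) = ⊤}) := by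
  have hcount (x : Fin e → G ⧸ A) := card_lifts_eq_pow_mul A B
    (fun y => Subgroup.closure (Set.range y) = ⊤) x
  simp only [Nat.card_fin] at hcount
  refine ⟨hcount, fun x hx => ?_, fun x₁ x₂ h₁ h₂ => ?_⟩
  · obtain ⟨y, hy⟩ := hgen
    have hy' : Subgroup.closure (Set.range fun i => quotBtoAB A B (y i)) = ⊤ := by
      rw [Set.range_comp' (quotBtoAB A B) y, ← MonoidHom.map_closure, hy,
        Subgroup.map_top_of_surjective _ (quotBtoAB_surjective A B)]
    have : Nonempty {z : Fin e → G ⧸ B // Subgroup.closure (Set.range z) = ⊤ ∧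
        (fun i => quotBtoAB A B (z i)) = fun i => quotBtoAB A B (y i)} := ⟨⟨y, hy, rfl⟩⟩
    rw [hcount, card_generating_lifts_eq (quotBtoAB A B) hx hy']
    exact mul_ne_zero (pow_ne_zero _ Nat.card_pos.ne') Nat.card_pos.ne'
  · rw [hcount, hcount, card_generating_lifts_eq (quotBtoAB A B) h₁ h₂]
end

section
/- Let k be a perfect field, K a field extension of k in which k is relatively algebraically closed, e ≥ 1 an integer, M a finite Galois extension of K, and L an intermediate field of M/K which is Galois over K. Let k_L and k_M be the relative algebraic closures of k in L and in M, and assume that Gal(k_M/k) can be generated by e elements. Let σ̄ ∈ Gal(L/K)^e satisfy Fix(σ̄) ∩ k_L = k. Then the cardinality of {τ̄ ∈ Gal(M/K)^e : τ̄ restricts to σ̄ on L, and Fix(τ̄) ∩ k_M = k} equals |{ρ̄ ∈ Gal(k_M/k)^e : ρ̄ restricts on k_L to the restriction of σ̄ to k_L, and ρ̄ generates Gal(k_M/k)}| · [M : k_M·L]^e, where k_M·L is the compositum of k_M and L inside M and [M : k_M·L] is the field extension degree. In particular this cardinality does not depend on the choice of σ̄ with Fix(σ̄) ∩ k_L = k.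 -/
section GroupCounting

open Classical in
/-- Refinement of Gaschütz's lemma: the number of tuples lifting a generating tuple of a quotient and
generating a prescribed subgroup does not depend on the generating tuple of the quotient. -/
theorem card_lifts_closure_eq_s3 {B C ι : Type*} [Group B] [Finite B] [Group C] [Finite ι]
    (π : B →* C) {c c' : ι → C} (hc : Subgroup.closure (Set.range c) = ⊤)
    (hc' : Subgroup.closure (Set.range c') = ⊤) (H : Subgroup B) :
    Nat.card {ρ : ι → B // (∀ i, π (ρ i) = c i) ∧ Subgroup.closure (Set.range ρ) = H} =
      Nat.card {ρ : ι → B // (∀ i, π (ρ i) = c' i) ∧ Subgroup.closure (Set.range ρ) = H} := by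
  have := Fintype.ofFinite B
  have := Fintype.ofFinite ι
  have := Fintype.ofFinite (Subgroup B)
  have map_closure {d : ι → C} (hd : Subgroup.closure (Set.range d) = ⊤) {ρ : ι → B}
      (hρ : ∀ i, π (ρ i) = d i) : (Subgroup.closure (Set.range ρ)).map π = ⊤ := by
    rw [MonoidHom.map_closure, ← Set.range_comp, show π ∘ ρ = d from funext hρ, hd]
  induction H using WellFoundedLT.induction with
  | ind H ih =>
  by_cases hH : H.map π = ⊤
  swap
  · have empty {d : ι → C} (hd : Subgroup.closure (Set.range d) = ⊤) :
        IsEmpty {ρ : ι → B // (∀ i, π (ρ i) = d i) ∧ Subgroup.closure (Set.range ρ) = H} :=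
      ⟨fun ρ ↦ hH (ρ.2.2 ▸ map_closure hd ρ.2.1)⟩
    have := empty hc
    have := empty hc'
    simp
  have lift (d : ι → C) (i : ι) : ∃ h ∈ H, π h = d i := by
    have : d i ∈ H.map π := hH ▸ Subgroup.mem_top _
    simpa using this
  choose h hmem hπ using lift
  have total : Nat.card {ρ : ι → B // (∀ i, π (ρ i) = c i) ∧ ∀ i, ρ i ∈ H} =
      Nat.card {ρ : ι → B // (∀ i, π (ρ i) = c' i) ∧ ∀ i, ρ i ∈ H} := by
    refine Nat.card_congr ((Equiv.piCongrRight fun i ↦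
      Equiv.mulLeft (h c' i * (h c i)⁻¹)).subtypeEquiv fun ρ ↦ ?_)
    refine and_congr (forall_congr' fun i ↦ ?_) (forall_congr' fun i ↦ ?_)
    · simp only [Equiv.piCongrRight_apply, Pi.map_apply, Equiv.coe_mulLeft, map_mul, map_inv, hπ,
        mul_assoc, mul_eq_left, inv_mul_eq_one]
      exact eq_comm
    · exact (H.mul_mem_cancel_left (H.mul_mem (hmem _ _) (H.inv_mem (hmem _ _)))).symm
  have decompose (d : ι → C) :
      Nat.card {ρ : ι → B // (∀ i, π (ρ i) = d i) ∧ ∀ i, ρ i ∈ H} =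
        ∑ H' ∈ Finset.univ.filter (· ≤ H), Nat.card
          {ρ : ι → B // (∀ i, π (ρ i) = d i) ∧ Subgroup.closure (Set.range ρ) = H'} := by
    simp only [Nat.card_eq_fintype_card, Fintype.card_subtype]
    rw [Finset.card_eq_sum_card_fiberwise (f := fun ρ : ι → B ↦ Subgroup.closure (Set.range ρ))
      (t := Finset.univ.filter (· ≤ H))]
    · refine Finset.sum_congr rfl fun H' hH' ↦ congrArg _ ?_
      ext ρ
      simp only [Finset.mem_filter, Finset.mem_univ, true_and] at hH' ⊢
      refine ⟨fun hρ ↦ ⟨hρ.1.1, hρ.2⟩, fun hρ ↦ ⟨⟨hρ.1, fun i ↦ hH' ?_⟩, hρ.2⟩⟩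
      exact hρ.2 ▸ Subgroup.subset_closure (Set.mem_range_self i)
    · intro ρ hρ
      simp only [Finset.coe_filter, Finset.mem_univ, true_and, Set.mem_ofPred_eq] at hρ ⊢
      rw [Subgroup.closure_le]
      rintro _ ⟨i, rfl⟩
      exact hρ.2 i
  have hmem_filter : H ∈ Finset.univ.filter (· ≤ H) := by simp
  simp only [decompose, ← Finset.add_sum_erase _ _ hmem_filter] at total
  refine Nat.add_right_cancel (total.trans (congrArg _ (Finset.sum_congr rfl fun H' hH' ↦ ?_)))
  simp only [Finset.mem_erase, Finset.mem_filter, Finset.mem_univ, true_and] at hH'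
  exact (ih H' (lt_of_le_of_ne hH'.2 hH'.1)).symm

/-- If every tuple satisfying `T` lifts along `p` compatibly with `a`, then each fibre of
`τ ↦ p ∘ τ` is a torsor under the tuples in `q.ker ⊓ p.ker`. -/
theorem card_tuples_eq_card_mul_card_ker_pow {G A B ι : Type*} [Group G] [Group A] [Group B]
    [Finite ι] (q : G →* A) (p : G →* B) (a : ι → A) (T : (ι → B) → Prop)
    (hT : ∀ ρ, T ρ → ∀ i, ∃ g, q g = a i ∧ p g = ρ i) :
    Nat.card {τ : ι → G // (∀ i, q (τ i) = a i) ∧ T (fun i ↦ p (τ i))} =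
      Nat.card {ρ : ι → B // T ρ} * Nat.card ↥(q.ker ⊓ p.ker) ^ Nat.card ι := by
  choose g hq hp using hT
  let f : {τ : ι → G // (∀ i, q (τ i) = a i) ∧ T (fun i ↦ p (τ i))} ≃
      {ρ : ι → B // T ρ} × (ι → ↥(q.ker ⊓ p.ker)) :=
    { toFun := fun τ ↦ (⟨_, τ.2.2⟩, fun i ↦ ⟨(g _ τ.2.2 i)⁻¹ * τ.1 i, by
        simp [Subgroup.mem_inf, MonoidHom.mem_ker, hq, hp, τ.2.1]⟩)
      invFun := fun x ↦ ⟨fun i ↦ g _ x.1.2 i * x.2 i, by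
        have h1 (i) : q (x.2 i) = 1 := (x.2 i).2.1
        have h2 (i) : p (x.2 i) = 1 := (x.2 i).2.2
        simp [h1, h2, hq, hp, x.1.2]⟩
      left_inv := fun τ ↦ by simp
      right_inv := fun ⟨⟨ρ, hρ⟩, n⟩ ↦ by
        have h2 (i) : p (n i) = 1 := (n i).2.2
        simp [h2, hp] }
  rw [Nat.card_congr f, Nat.card_prod, Nat.card_fun]

end GroupCounting

section AlgebraicClosure

variable {k K M : Type*} [Field k] [Field K] [Field M] [Algebra k K] [Algebra K M] [Algebra k M]
  [IsScalarTower k K M]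

/-- Restriction of automorphisms of `M` over `K` to the relative algebraic closure of `k` in `M`. -/
def algebraicClosureRestrictHom (k K M : Type*) [Field k] [Field K] [Field M] [Algebra k K]
    [Algebra K M] [Algebra k M] [IsScalarTower k K M] :
    (M ≃ₐ[K] M) →* (algebraicClosure k M ≃ₐ[k] algebraicClosure k M) where
  toFun g := algebraicClosure.algEquivOfAlgEquiv (g.restrictScalars k)
  map_one' := rfl
  map_mul' _ _ := rfl

@[simp]
theorem coe_algebraicClosureRestrictHom_apply (g : M ≃ₐ[K] M) (x : algebraicClosure k M) :
    (algebraicClosureRestrictHom k K M g x : M) = g x :=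
  rfl

variable [FiniteDimensional K M]

instance finite_range_algebraicClosureRestrictHom :
    Finite (algebraicClosureRestrictHom k K M).range :=
  Finite.of_surjective _ (algebraicClosureRestrictHom k K M).rangeRestrict_surjective

variable [IsGalois K M]

theorem isGaloisGroup_range_algebraicClosureRestrictHom
    (hreg : ∀ x : K, IsAlgebraic k x → x ∈ (algebraMap k K).range) :
    IsGaloisGroup (algebraicClosureRestrictHom k K M).range k (algebraicClosure k M) where
  faithful := inferInstance
  commutes := inferInstance
  isInvariant := ⟨fun x hx ↦ by
    have hfix (g : M ≃ₐ[K] M) : g x = x :=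
      congrArg Subtype.val (hx ⟨_, MonoidHom.mem_range.mpr ⟨g, rfl⟩⟩)
    obtain ⟨y, hy⟩ := (IsGalois.mem_range_algebraMap_iff_fixed (F := K) (x : M)).mpr hfix
    have hx_alg : IsAlgebraic k (x : M) := mem_algebraicClosure_iff.mp x.2
    rw [← hy, isAlgebraic_algebraMap_iff (algebraMap K M).injective] at hx_alg
    obtain ⟨z, rfl⟩ := hreg y hx_alg
    exact ⟨z, Subtype.ext ((IsScalarTower.algebraMap_apply k K M z).trans hy)⟩⟩

theorem finiteDimensional_algebraicClosure_of_isGalois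
    (hreg : ∀ x : K, IsAlgebraic k x → x ∈ (algebraMap k K).range) :
    FiniteDimensional k (algebraicClosure k M) := by
  have := isGaloisGroup_range_algebraicClosureRestrictHom (M := M) hreg
  exact IsGaloisGroup.finiteDimensional (algebraicClosureRestrictHom k K M).range _ _

theorem isGalois_algebraicClosure_of_isGalois
    (hreg : ∀ x : K, IsAlgebraic k x → x ∈ (algebraMap k K).range) :
    IsGalois k (algebraicClosure k M) := by
  have := isGaloisGroup_range_algebraicClosureRestrictHom (M := M) hreg
  exact IsGaloisGroup.isGalois (algebraicClosureRestrictHom k K M).range _ _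

theorem algebraicClosureRestrictHom_surjective
    (hreg : ∀ x : K, IsAlgebraic k x → x ∈ (algebraMap k K).range) :
    Function.Surjective (algebraicClosureRestrictHom k K M) := by
  have := isGaloisGroup_range_algebraicClosureRestrictHom (M := M) hreg
  have := finiteDimensional_algebraicClosure_of_isGalois (M := M) hreg
  have := isGalois_algebraicClosure_of_isGalois (M := M) hreg
  rw [← MonoidHom.range_eq_top]
  apply Subgroup.eq_top_of_card_eq
  rw [IsGaloisGroup.card_eq_finrank (algebraicClosureRestrictHom k K M).range k
    (algebraicClosure k M), IsGalois.card_aut_eq_finrank]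

theorem mem_map_fixingSubgroup_algebraicClosureRestrictHom
    [FiniteDimensional k (algebraicClosure k M)] (L : IntermediateField K M)
    {b : algebraicClosure k M ≃ₐ[k] algebraicClosure k M} :
    b ∈ L.fixingSubgroup.map (algebraicClosureRestrictHom k K M) ↔
      ∀ x : algebraicClosure k M, (x : M) ∈ L → b x = x := by
  constructor
  · rintro ⟨g, hg, rfl⟩ x hx
    exact Subtype.ext ((L.mem_fixingSubgroup_iff g).mp hg x hx)
  · intro hb
    rw [← IntermediateField.fixingSubgroup_fixedField (L.fixingSubgroup.map _),
      IntermediateField.mem_fixingSubgroup_iff]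
    refine fun x hx ↦ hb x ?_
    rw [← IsGalois.fixedField_fixingSubgroup L, IntermediateField.mem_fixedField_iff]
    exact fun g hg ↦ congrArg Subtype.val
      ((IntermediateField.mem_fixedField_iff _ _).mp hx _ (Subgroup.mem_map_of_mem _ hg))

theorem inv_mul_mem_map_fixingSubgroup_algebraicClosureRestrictHom
    [FiniteDimensional k (algebraicClosure k M)] (L : IntermediateField K M) [Normal K L]
    (g : M ≃ₐ[K] M) (b : algebraicClosure k M ≃ₐ[k] algebraicClosure k M) :
    (algebraicClosureRestrictHom k K M g)⁻¹ * b ∈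
        L.fixingSubgroup.map (algebraicClosureRestrictHom k K M) ↔
      ∀ (x : M) (hxL : x ∈ L) (hxa : x ∈ algebraicClosure k M),
        ((b ⟨x, hxa⟩ : algebraicClosure k M) : M) =
          ((AlgEquiv.restrictNormalHom L g ⟨x, hxL⟩ : L) : M) := by
  have hinv (x : algebraicClosure k M) :
      ((algebraicClosureRestrictHom k K M g)⁻¹ * b) x = x ↔ (b x : M) = g x := by
    rw [← coe_algebraicClosureRestrictHom_apply (k := k) g x, ← Subtype.ext_iff]
    exact AlgEquiv.symm_apply_eq (algebraicClosureRestrictHom k K M g)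
  simp only [mem_map_fixingSubgroup_algebraicClosureRestrictHom, hinv,
    AlgEquiv.restrictNormalHom_apply]
  exact ⟨fun h x hxL hxa ↦ h ⟨x, hxa⟩ hxL, fun h x hxL ↦ h x hxL x.2⟩

theorem closure_range_eq_top_iff_forall_mem_range {F E ι : Type*} [Field F] [Field E] [Algebra F E]
    [FiniteDimensional F E] [IsGalois F E] (ρ : ι → E ≃ₐ[F] E) :
    Subgroup.closure (Set.range ρ) = ⊤ ↔
      ∀ x : E, (∀ i, ρ i x = x) → x ∈ (algebraMap F E).range := by
  have hfix (x : E) : x ∈ IntermediateField.fixedField (Subgroup.closure (Set.range ρ)) ↔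
      ∀ i, ρ i x = x := by
    rw [IntermediateField.mem_fixedField_iff]
    refine ⟨fun h i ↦ h _ (Subgroup.subset_closure (Set.mem_range_self i)), fun h f hf ↦ ?_⟩
    induction hf using Subgroup.closure_induction with
    | mem f hf => obtain ⟨i, rfl⟩ := hf; exact h i
    | one => rfl
    | mul f g _ _ hf hg => rw [AlgEquiv.mul_apply, hg, hf]
    | inv f _ hf => exact (AlgEquiv.symm_apply_eq f).mpr hf.symm
  rw [← IntermediateField.fixingSubgroup_bot,
    ← IsGalois.fixedField_eq_iff_fixingSubgroup_eq.trans eq_comm, eq_bot_iff]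
  exact forall_congr' fun x ↦ imp_congr (hfix x) Iff.rfl

theorem card_ker_restrictNormalHom_inf_ker (L : IntermediateField K M) [Normal K L] :
    Nat.card ↥((AlgEquiv.restrictNormalHom L).ker ⊓ (algebraicClosureRestrictHom k K M).ker :
        Subgroup (M ≃ₐ[K] M)) =
      Module.finrank ↥(algebraicClosure k M ⊔ L.restrictScalars k) M := by
  let F : IntermediateField K M :=
    { (algebraicClosure k M ⊔ L.restrictScalars k : IntermediateField k M) with
      algebraMap_mem' := fun r ↦ (le_sup_right : L.restrictScalars k ≤ algebraicClosure k M ⊔ _)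
        (L.algebraMap_mem r) }
  have hF : (AlgEquiv.restrictNormalHom L).ker ⊓ (algebraicClosureRestrictHom k K M).ker =
      F.fixingSubgroup := by
    ext g
    rw [IntermediateField.restrictNormalHom_ker, Subgroup.mem_inf,
      IntermediateField.mem_fixingSubgroup_iff, IntermediateField.mem_fixingSubgroup_iff,
      MonoidHom.mem_ker]
    constructor
    · rintro ⟨hL, hE⟩
      have hle : algebraicClosure k M ⊔ L.restrictScalars k ≤
          IntermediateField.fixedField (Subgroup.zpowers (g.restrictScalars k)) := by
        rw [IntermediateField.le_iff_le, Subgroup.zpowers_le, IntermediateField.fixingSubgroup_sup]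
        refine ⟨(IntermediateField.mem_fixingSubgroup_iff _ _).mpr fun x hx ↦ ?_,
          (IntermediateField.mem_fixingSubgroup_iff _ _).mpr hL⟩
        exact congrArg Subtype.val (AlgEquiv.congr_fun hE ⟨x, hx⟩)
      exact fun x hx ↦ (IntermediateField.mem_fixedField_iff _ _).mp (hle hx) _
        (Subgroup.mem_zpowers _)
    · refine fun h ↦ ⟨fun x hx ↦ h x ?_, AlgEquiv.ext fun x ↦ Subtype.ext (h x ?_)⟩
      · exact (le_sup_right : L.restrictScalars k ≤ algebraicClosure k M ⊔ _) hx
      · exact (le_sup_left : _ ≤ algebraicClosure k M ⊔ L.restrictScalars k) x.2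
  rw [hF]
  exact IsGalois.card_fixingSubgroup_eq_finrank F

section Lifting

variable [FiniteDimensional k (algebraicClosure k M)]
  (L : IntermediateField K M) [IsGalois K L]

theorem exists_restrictNormalHom_eq_and_algebraicClosureRestrictHom_eq (s : L ≃ₐ[K] L)
    (b : algebraicClosure k M ≃ₐ[k] algebraicClosure k M)
    (h : ∀ (x : M) (hxL : x ∈ L) (hxa : x ∈ algebraicClosure k M),
      ((b ⟨x, hxa⟩ : algebraicClosure k M) : M) = ((s ⟨x, hxL⟩ : L) : M)) :
    ∃ g : M ≃ₐ[K] M, AlgEquiv.restrictNormalHom L g = s ∧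
      algebraicClosureRestrictHom k K M g = b := by
  obtain ⟨g, rfl⟩ := AlgEquiv.restrictNormalHom_surjective (K₁ := L) M s
  have hb : (algebraicClosureRestrictHom k K M g)⁻¹ * b ∈
      L.fixingSubgroup.map (algebraicClosureRestrictHom k K M) := by
    rwa [inv_mul_mem_map_fixingSubgroup_algebraicClosureRestrictHom]
  obtain ⟨n, hn, hnb⟩ := hb
  refine ⟨g * n, ?_, by rw [map_mul, hnb, mul_inv_cancel_left]⟩
  rw [SetLike.mem_coe, ← IntermediateField.restrictNormalHom_ker, MonoidHom.mem_ker] at hn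
  rw [map_mul, hn, mul_one]

variable [IsGalois k (algebraicClosure k M)] {ι : Type*} [Finite ι]

theorem card_lifts_eq_card_mul_finrank_pow (σ : ι → (L ≃ₐ[K] L)) :
    Nat.card {τ : ι → (M ≃ₐ[K] M) //
        (∀ i, ∀ x : L, τ i (x : M) = ((σ i x : L) : M)) ∧
        (∀ x : M, ((∀ i, τ i x = x) ∧ IsAlgebraic k x) ↔ x ∈ (algebraMap k M).range)}
      = Nat.card {ρ : ι → (algebraicClosure k M ≃ₐ[k] algebraicClosure k M) //
          (∀ i, ∀ (x : M) (hxL : x ∈ L) (hxa : x ∈ algebraicClosure k M),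
            ((ρ i ⟨x, hxa⟩ : algebraicClosure k M) : M) = ((σ i ⟨x, hxL⟩ : L) : M)) ∧
          Subgroup.closure (Set.range ρ) = ⊤}
        * (Module.finrank ↥(algebraicClosure k M ⊔ L.restrictScalars k) M) ^ Nat.card ι := by
  rw [← card_ker_restrictNormalHom_inf_ker, ← card_tuples_eq_card_mul_card_ker_pow _ _ σ _
    fun ρ hρ i ↦ exists_restrictNormalHom_eq_and_algebraicClosureRestrictHom_eq L _ _ (hρ.1 i)]
  refine Nat.card_congr (Equiv.subtypeEquivRight fun τ ↦ ?_)
  have hres (i : ι) : AlgEquiv.restrictNormalHom L (τ i) = σ i ↔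
      ∀ x : L, τ i (x : M) = ((σ i x : L) : M) := by
    simp only [AlgEquiv.ext_iff, Subtype.ext_iff, AlgEquiv.restrictNormalHom_apply]
  simp only [hres]
  refine and_congr_right fun hτ ↦ ?_
  rw [closure_range_eq_top_iff_forall_mem_range]
  constructor
  · refine fun h ↦ ⟨fun i x hxL hxa ↦ hτ i ⟨x, hxL⟩, fun x hx ↦ ?_⟩
    obtain ⟨y, hy⟩ := (h x).mp
      ⟨fun i ↦ congrArg Subtype.val (hx i), mem_algebraicClosure_iff.mp x.2⟩
    exact ⟨y, Subtype.ext hy⟩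
  · refine fun h x ↦ ⟨fun hx ↦ ?_, ?_⟩
    · obtain ⟨y, hy⟩ := h.2 ⟨x, mem_algebraicClosure_iff.mpr hx.2⟩ fun i ↦ Subtype.ext (hx.1 i)
      exact ⟨y, congrArg Subtype.val hy⟩
    · rintro ⟨y, rfl⟩
      exact ⟨fun i ↦ ((τ i).restrictScalars k).commutes y, isAlgebraic_algebraMap y⟩

theorem card_generating_lifts_eq_s3 {σ σ' : ι → (L ≃ₐ[K] L)}
    (hsurj : Function.Surjective (algebraicClosureRestrictHom k K M))
    (hσ : ∀ x : L, ((∀ i, σ i x = x) ∧ IsAlgebraic k (x : M)) ↔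
      (x : M) ∈ (algebraMap k M).range)
    (hσ' : ∀ x : L, ((∀ i, σ' i x = x) ∧ IsAlgebraic k (x : M)) ↔
      (x : M) ∈ (algebraMap k M).range) :
    Nat.card {ρ : ι → (algebraicClosure k M ≃ₐ[k] algebraicClosure k M) //
          (∀ i, ∀ (x : M) (hxL : x ∈ L) (hxa : x ∈ algebraicClosure k M),
            ((ρ i ⟨x, hxa⟩ : algebraicClosure k M) : M) = ((σ i ⟨x, hxL⟩ : L) : M)) ∧
          Subgroup.closure (Set.range ρ) = ⊤} =
      Nat.card {ρ : ι → (algebraicClosure k M ≃ₐ[k] algebraicClosure k M) //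
          (∀ i, ∀ (x : M) (hxL : x ∈ L) (hxa : x ∈ algebraicClosure k M),
            ((ρ i ⟨x, hxa⟩ : algebraicClosure k M) : M) = ((σ' i ⟨x, hxL⟩ : L) : M)) ∧
          Subgroup.closure (Set.range ρ) = ⊤} := by
  let p := algebraicClosureRestrictHom k K M
  let N := L.fixingSubgroup.map p
  have : N.Normal := Subgroup.Normal.map inferInstance p hsurj
  choose g hg using AlgEquiv.restrictNormalHom_surjective (F := K) (K₁ := L) M
  have hcompat (s : L ≃ₐ[K] L) (b : algebraicClosure k M ≃ₐ[k] algebraicClosure k M) :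
      (∀ (x : M) (hxL : x ∈ L) (hxa : x ∈ algebraicClosure k M),
        ((b ⟨x, hxa⟩ : algebraicClosure k M) : M) = ((s ⟨x, hxL⟩ : L) : M)) ↔
      QuotientGroup.mk' N b = QuotientGroup.mk' N (p (g s)) := by
    rw [eq_comm, QuotientGroup.mk'_apply, QuotientGroup.mk'_apply, QuotientGroup.eq,
      inv_mul_mem_map_fixingSubgroup_algebraicClosureRestrictHom, hg]
  have hgen {s : ι → (L ≃ₐ[K] L)} (hs : ∀ x : L, ((∀ i, s i x = x) ∧ IsAlgebraic k (x : M)) ↔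
      (x : M) ∈ (algebraMap k M).range) :
      Subgroup.closure (Set.range fun i ↦ QuotientGroup.mk' N (p (g (s i)))) = ⊤ := by
    set c := fun i ↦ QuotientGroup.mk' N (p (g (s i)))
    let H := (Subgroup.closure (Set.range c)).comap (QuotientGroup.mk' N)
    have hH : H = ⊤ := by
      have hclosure : Subgroup.closure (Set.range ((↑) : H → _)) = H :=
        (congrArg _ Subtype.range_coe).trans H.closure_eq
      rw [← hclosure, closure_range_eq_top_iff_forall_mem_range]
      intro x hx
      have hN (n : M ≃ₐ[K] M) (hn : n ∈ L.fixingSubgroup) : p n x = x := by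
        refine hx ⟨p n, Subgroup.mem_comap.mpr ?_⟩
        rw [QuotientGroup.mk'_apply, (QuotientGroup.eq_one_iff _).mpr (Subgroup.mem_map_of_mem p hn)]
        exact Subgroup.one_mem _
      have hxL : (x : M) ∈ L := by
        rw [← IsGalois.fixedField_fixingSubgroup L, IntermediateField.mem_fixedField_iff]
        exact fun n hn ↦ congrArg Subtype.val (hN n hn)
      have hsx (i : ι) : s i ⟨x, hxL⟩ = ⟨x, hxL⟩ := by
        rw [Subtype.ext_iff, ← hg (s i), AlgEquiv.restrictNormalHom_apply]
        exact congrArg Subtype.val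
          (hx ⟨p (g (s i)), Subgroup.subset_closure (Set.mem_range_self i)⟩)
      obtain ⟨y, hy⟩ := (hs ⟨x, hxL⟩).mp ⟨hsx, mem_algebraicClosure_iff.mp x.2⟩
      exact ⟨y, Subtype.ext hy⟩
    rw [← Subgroup.map_comap_eq_self_of_surjective (QuotientGroup.mk'_surjective N)
      (Subgroup.closure (Set.range c))]
    change H.map _ = ⊤
    rw [hH, Subgroup.map_top_of_surjective _ (QuotientGroup.mk'_surjective N)]
  simp only [hcompat]
  exact card_lifts_closure_eq_s3 (QuotientGroup.mk' N) (hgen hσ) (hgen hσ') ⊤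

end Lifting

end AlgebraicClosure



/-- The key counting claim in the proof that the measure is well defined:
let `k` be perfect and relatively algebraically closed in `K`, let `M/K` be finite
Galois, `L` an intermediate field of `M/K` Galois over `K`, `k_L`, `k_M` the
relative algebraic closures of `k` in `L`, `M` (here `k_M = algebraicClosure k M`,
and `k_L` consists of the elements of `L` algebraic over `k`), and assume
`Gal(k_M/k)` is generated by `e` elements.  If `σ̄ ∈ Gal(L/K)^e` satisfies
`Fix(σ̄) ∩ k_L = k`, then the number of `τ̄ ∈ Gal(M/K)^e` restricting to `σ̄` on `L`
with `Fix(τ̄) ∩ k_M = k` equals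
`|{ρ̄ ∈ Gal(k_M/k)^e : ρ̄|k_L = σ̄|k_L and ρ̄ generates Gal(k_M/k)}| · [M : k_M·L]^e`;
in particular it does not depend on the choice of such `σ̄`. -/
theorem stmt_3 (k K M : Type*) [Field k] [Field K] [Field M]
    [Algebra k K] [Algebra K M] [Algebra k M] [IsScalarTower k K M]
    [PerfectField k]
    (hreg : ∀ x : K, IsAlgebraic k x → x ∈ (algebraMap k K).range)
    (e : ℕ) (he : 1 ≤ e)
    [FiniteDimensional K M] [IsGalois K M]
    (L : IntermediateField K M) [IsGalois K L]
    (hgenM : ∃ ρ : Fin e → (algebraicClosure k M ≃ₐ[k] algebraicClosure k M),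
      Subgroup.closure (Set.range ρ) = ⊤)
    (σ : Fin e → (L ≃ₐ[K] L))
    (hσ : ∀ x : L, ((∀ i, σ i x = x) ∧ IsAlgebraic k (x : M)) ↔
      (x : M) ∈ (algebraMap k M).range) :
    (Nat.card {τ : Fin e → (M ≃ₐ[K] M) //
        (∀ i, ∀ x : L, τ i (x : M) = ((σ i x : L) : M)) ∧
        (∀ x : M, ((∀ i, τ i x = x) ∧ IsAlgebraic k x) ↔ x ∈ (algebraMap k M).range)}
      = Nat.card {ρ : Fin e → (algebraicClosure k M ≃ₐ[k] algebraicClosure k M) //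
          (∀ i, ∀ (x : M) (hxL : x ∈ L) (hxa : x ∈ algebraicClosure k M),
            ((ρ i ⟨x, hxa⟩ : algebraicClosure k M) : M) = ((σ i ⟨x, hxL⟩ : L) : M)) ∧
          Subgroup.closure (Set.range ρ) = ⊤}
        * (Module.finrank ↥(algebraicClosure k M ⊔ L.restrictScalars k) M) ^ e)
    ∧
    (∀ σ' : Fin e → (L ≃ₐ[K] L),
      (∀ x : L, ((∀ i, σ' i x = x) ∧ IsAlgebraic k (x : M)) ↔
        (x : M) ∈ (algebraMap k M).range) →
      Nat.card {τ : Fin e → (M ≃ₐ[K] M) //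
        (∀ i, ∀ x : L, τ i (x : M) = ((σ i x : L) : M)) ∧
        (∀ x : M, ((∀ i, τ i x = x) ∧ IsAlgebraic k x) ↔ x ∈ (algebraMap k M).range)}
      = Nat.card {τ : Fin e → (M ≃ₐ[K] M) //
        (∀ i, ∀ x : L, τ i (x : M) = ((σ' i x : L) : M)) ∧
        (∀ x : M, ((∀ i, τ i x = x) ∧ IsAlgebraic k x) ↔ x ∈ (algebraMap k M).range)}) := by
  have := finiteDimensional_algebraicClosure_of_isGalois (M := M) hreg
  have := isGalois_algebraicClosure_of_isGalois (M := M) hreg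
  have count (s : Fin e → (L ≃ₐ[K] L)) := card_lifts_eq_card_mul_finrank_pow (k := k) L s
  rw [Nat.card_fin] at count
  refine ⟨count σ, fun σ' hσ' ↦ ?_⟩
  rw [count σ, count σ', card_generating_lifts_eq_s3 L
    (algebraicClosureRestrictHom_surjective hreg) hσ hσ']
end

section
/- Let k be a perfect field, K a field extension of k in which k is relatively algebraically closed, e ≥ 1 an integer, M a finite Galois extension of K, and L an intermediate field of M/K which is Galois over K. Let k_L and k_M be the relative algebraic closures of k in L and in M, and assume that Gal(k_M/k) can be generated by e elements. Let K' be an intermediate field of L/K in which k is relatively algebraically closed. Then |{σ̄ ∈ Gal(L/K)^e : Fix(σ̄) ≅_K K'}| · |{τ̄ ∈ Gal(M/K)^e : Fix(τ̄) ∩ k_M = k}| = |{τ̄ ∈ Gal(M/K)^e : Fix(τ̄) ∩ k_M = k and Fix(τ̄) ∩ L ≅_K K'}| · |{σ̄ ∈ Gal(L/K)^e : Fix(σ̄) ∩ k_L = k}|. (This expresses that the measure of the paper does not depend on the finite Galois extension used to compute it.) -/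
/-- The fixed field `Fix(σ̄) = {x : ∀ i, σᵢ x = x}` of a tuple of automorphisms. -/
def fixTuple {F E : Type*} [Field F] [Field E] [Algebra F E] {e : ℕ}
    (σ : Fin e → (E ≃ₐ[F] E)) : IntermediateField F E where
  carrier := {x : E | ∀ i, σ i x = x}
  mul_mem' := fun {a b} ha hb i => by rw [map_mul, ha i, hb i]
  add_mem' := fun {a b} ha hb i => by rw [map_add, ha i, hb i]
  one_mem' := fun i => map_one (σ i)
  zero_mem' := fun i => map_zero (σ i)
  algebraMap_mem' := fun r i => (σ i).commutes r
  inv_mem' := fun a ha i => by rw [map_inv₀, ha i]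

/-- The number of lifts of `σ` along `π` that generate `U` modulo `P`. -/
noncomputable def numLifts {G H ι : Type*} [Group G] [Group H] (π : G →* H) (P : Subgroup G)
    (σ : ι → H) (U : Subgroup G) : ℕ :=
  Nat.card {τ : ι → G // (∀ i, π (τ i) = σ i) ∧ Subgroup.closure (Set.range τ) ⊔ P = U}

open Classical in
/-- The lifts of `σ` with entries in `U ≥ P`, sorted by what they generate modulo `P`. -/
theorem card_lifts_mem_eq_sum_s4 {G H ι : Type*} [Group G] [Group H] [Finite G] [Finite ι]
    [Fintype (Subgroup G)] (π : G →* H) (P : Subgroup G) (σ : ι → H) {U : Subgroup G}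
    (hPU : P ≤ U) :
    Nat.card {τ : ι → G // (∀ i, π (τ i) = σ i) ∧ ∀ i, τ i ∈ U} =
      numLifts π P σ U + ∑ V with V < U, numLifts π P σ V := by
  have := Fintype.ofFinite (ι → G)
  have hsplit : Finset.univ.filter (· ≤ U) = insert U (Finset.univ.filter (· < U)) := by
    ext V
    simp [le_iff_eq_or_lt]
  rw [← Finset.sum_insert (by simp), ← hsplit, Nat.card_eq_fintype_card, Fintype.card_subtype,
    Finset.card_eq_sum_card_fiberwise
      (f := fun τ : ι → G => Subgroup.closure (Set.range τ) ⊔ P)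
      (t := Finset.univ.filter (· ≤ U))]
  · refine Finset.sum_congr rfl fun V hV => ?_
    rw [numLifts, Nat.card_eq_fintype_card, Fintype.card_subtype, Finset.filter_filter]
    congr 1
    refine Finset.filter_congr fun τ _ =>
      ⟨fun h => ⟨h.1.1, h.2⟩, fun h => ⟨⟨h.1, fun i => ?_⟩, h.2⟩⟩
    refine (Finset.mem_filter.1 hV).2 (h.2 ▸ ?_)
    exact Subgroup.mem_sup_left (Subgroup.subset_closure ⟨i, rfl⟩)
  · intro τ hτ
    simp only [Finset.coe_filter, Finset.mem_univ, true_and, Set.mem_ofPred_eq] at hτ ⊢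
    refine sup_le ((Subgroup.closure_le _).2 ?_) hPU
    rintro _ ⟨i, rfl⟩
    exact hτ.2 i

/-- If `U` surjects onto `H`, the number of lifts with entries in `U` does not depend on the
tuple. -/
theorem card_lifts_mem_eq_s4 {G H ι : Type*} [Group G] [Group H]
    (π : G →* H) {U : Subgroup G} (hU : U.map π = ⊤) (σ σ' : ι → H) :
    Nat.card {τ : ι → G // (∀ i, π (τ i) = σ i) ∧ ∀ i, τ i ∈ U} =
      Nat.card {τ : ι → G // (∀ i, π (τ i) = σ' i) ∧ ∀ i, τ i ∈ U} := by
  have hex (i : ι) : ∃ u ∈ U, π u = (σ i)⁻¹ * σ' i := by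
    have : (σ i)⁻¹ * σ' i ∈ U.map π := hU ▸ Subgroup.mem_top _
    simpa using this
  choose u huU hu using hex
  refine Nat.card_congr ((Equiv.mulRight u).subtypeEquiv fun τ => ?_)
  simp only [Equiv.coe_mulRight, Pi.mul_apply, map_mul, hu]
  refine and_congr (forall_congr' fun i => ?_)
    (forall_congr' fun i => (U.mul_mem_cancel_right (huU i)).symm)
  rw [← mul_assoc, mul_eq_right, mul_inv_eq_one]

theorem map_closure_range_sup {G H ι : Type*} [Group G] [Group H] (π : G →* H) (P : Subgroup G)
    (τ : ι → G) :
    (Subgroup.closure (Set.range τ) ⊔ P).map π =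
      Subgroup.closure (Set.range fun i => π (τ i)) ⊔ P.map π := by
  rw [Subgroup.map_sup, MonoidHom.map_closure, ← Set.range_comp]
  rfl

theorem numLifts_eq_zero {G H ι : Type*} [Group G] [Group H] {π : G →* H} {P : Subgroup G}
    {σ : ι → H} {U : Subgroup G}
    (h : ¬ (P ≤ U ∧ U.map π = Subgroup.closure (Set.range σ) ⊔ P.map π)) :
    numLifts π P σ U = 0 := by
  refine Nat.card_eq_zero.2 (.inl ⟨fun ⟨τ, hτ, hU⟩ => h ⟨hU ▸ le_sup_right, ?_⟩⟩)
  rw [← hU, map_closure_range_sup, funext hτ]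

/-- **Gaschütz's lemma**, in counting form. -/
theorem numLifts_eq_numLifts {G H ι : Type*} [Group G] [Group H] [Finite G] [Finite ι]
    (π : G →* H) (P : Subgroup G) {σ σ' : ι → H}
    (hσ : Subgroup.closure (Set.range σ) ⊔ P.map π = ⊤)
    (hσ' : Subgroup.closure (Set.range σ') ⊔ P.map π = ⊤) (U : Subgroup G) :
    numLifts π P σ U = numLifts π P σ' U := by
  classical
  have := Fintype.ofFinite (Subgroup G)
  induction U using WellFoundedLT.induction with
  | ind U ih =>
  by_cases h : P ≤ U ∧ U.map π = ⊤
  · have hcard := card_lifts_mem_eq_s4 π h.2 σ σ'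
    rw [card_lifts_mem_eq_sum_s4 π P σ h.1, card_lifts_mem_eq_sum_s4 π P σ' h.1,
      Finset.sum_congr rfl fun V hV => ih V (Finset.mem_filter.1 hV).2] at hcard
    exact Nat.add_right_cancel hcard
  · rw [numLifts_eq_zero (hσ ▸ h), numLifts_eq_zero (hσ' ▸ h)]

/-- For a set `B` of tuples generating `H` modulo the image of `P`, the number of tuples over `B`
generating `G` modulo `P` is proportional to the number of elements of `B`. -/
theorem exists_card_eq_card_mul {G H ι : Type*} [Group G] [Group H] [Finite G] [Finite H]
    [Finite ι] (π : G →* H) (P : Subgroup G) :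
    ∃ c : ℕ, ∀ B : (ι → H) → Prop,
      (∀ σ, B σ → Subgroup.closure (Set.range σ) ⊔ P.map π = ⊤) →
      Nat.card {τ : ι → G // Subgroup.closure (Set.range τ) ⊔ P = ⊤ ∧ B fun i => π (τ i)} =
        Nat.card {σ // B σ} * c := by
  obtain ⟨c, hc⟩ : ∃ c, ∀ σ : ι → H, Subgroup.closure (Set.range σ) ⊔ P.map π = ⊤ →
      numLifts π P σ ⊤ = c := by
    by_cases h : ∃ σ₀ : ι → H, Subgroup.closure (Set.range σ₀) ⊔ P.map π = ⊤
    · obtain ⟨σ₀, h₀⟩ := h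
      exact ⟨_, fun σ hσ => numLifts_eq_numLifts π P hσ h₀ ⊤⟩
    · exact ⟨0, fun σ hσ => (h ⟨σ, hσ⟩).elim⟩
  refine ⟨c, fun B hB => ?_⟩
  have := Fintype.ofFinite {σ // B σ}
  let e : {τ : ι → G // Subgroup.closure (Set.range τ) ⊔ P = ⊤ ∧ B fun i => π (τ i)} ≃
      Σ σ : {σ // B σ}, {τ : ι → G // (∀ i, π (τ i) = σ.1 i) ∧
        Subgroup.closure (Set.range τ) ⊔ P = ⊤} :=
    { toFun τ := ⟨⟨_, τ.2.2⟩, τ.1, fun _ => rfl, τ.2.1⟩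
      invFun x := ⟨x.2.1, x.2.2.2, by rw [funext x.2.2.1]; exact x.1.2⟩
      left_inv _ := rfl
      right_inv := by
        rintro ⟨⟨σ, hσ⟩, τ, hτ, h⟩
        obtain rfl : (fun i => π (τ i)) = σ := funext hτ
        rfl }
  rw [Nat.card_congr e, Nat.card_sigma, Finset.sum_congr rfl fun σ _ => hc σ.1 (hB _ σ.2)]
  simp

/-- The proportion of tuples satisfying `B` is the same for tuples generating `H` modulo the image
of `P` and for tuples generating `G` modulo `P`. -/
theorem card_mul_card_eq_card_mul_card {G H ι : Type*} [Group G] [Group H] [Finite G] [Finite H]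
    [Finite ι] {π : G →* H} (hπ : Function.Surjective π) (P : Subgroup G)
    (B : (ι → H) → Prop)
    (hB : ∀ σ, B σ → Subgroup.closure (Set.range σ) ⊔ P.map π = ⊤) :
    Nat.card {σ // B σ} * Nat.card {τ : ι → G // Subgroup.closure (Set.range τ) ⊔ P = ⊤} =
      Nat.card {τ : ι → G // Subgroup.closure (Set.range τ) ⊔ P = ⊤ ∧ B fun i => π (τ i)} *
        Nat.card {σ : ι → H // Subgroup.closure (Set.range σ) ⊔ P.map π = ⊤} := by
  obtain ⟨c, hc⟩ := exists_card_eq_card_mul (ι := ι) π P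
  have htop := hc (fun σ => Subgroup.closure (Set.range σ) ⊔ P.map π = ⊤) fun _ => id
  have hiff (τ : ι → G) : (Subgroup.closure (Set.range τ) ⊔ P = ⊤ ∧
      Subgroup.closure (Set.range fun i => π (τ i)) ⊔ P.map π = ⊤) ↔
      Subgroup.closure (Set.range τ) ⊔ P = ⊤ := by
    refine and_iff_left_of_imp fun h => ?_
    rw [← map_closure_range_sup, h, Subgroup.map_top_of_surjective π hπ]
  simp_rw [hiff] at htop
  rw [htop, hc B hB]
  ring

/-- The automorphisms of `M/K` fixing the elements algebraic over `k`. -/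
def algebraicFixer (k K M : Type*) [Field k] [Field K] [Field M] [Algebra K M] [Algebra k M] :
    Subgroup (M ≃ₐ[K] M) where
  carrier := {g | ∀ x : M, IsAlgebraic k x → g x = x}
  mul_mem' ha hb x hx := by rw [AlgEquiv.mul_apply, hb x hx, ha x hx]
  one_mem' _ _ := rfl
  inv_mem' {g} hg x hx := by
    nth_rw 1 [← hg x hx]
    exact g.symm_apply_apply x

/-- The action of a group of `K`-automorphisms of `M` on the elements algebraic over `k`. -/
@[reducible] def algebraicClosureAction {k K M : Type*} [Field k] [Field K] [Field M]
    [Algebra k K] [Algebra K M] [Algebra k M] [IsScalarTower k K M] (U : Subgroup (M ≃ₐ[K] M)) :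
    MulSemiringAction U (algebraicClosure k M) where
  smul u x := ⟨u.1 x, x.2.map (u.1.toAlgHom.restrictScalars k)⟩
  one_smul _ := rfl
  mul_smul _ _ _ := rfl
  smul_zero u := Subtype.ext (map_zero u.1)
  smul_add u x y := Subtype.ext (map_add u.1 (x : M) y)
  smul_one u := Subtype.ext (map_one u.1)
  smul_mul u x y := Subtype.ext (map_mul u.1 (x : M) y)

/-- By Artin's theorem, the group of `K`-automorphisms of `M` acts on the algebraic closure of `k`
in `M` through `U` as soon as `U` has no fixed elements there other than those of `k`. -/
theorem sup_algebraicFixer_eq_top_iff {k K M : Type*} [Field k] [Field K] [Field M]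
    [Algebra k K] [Algebra K M] [Algebra k M] [IsScalarTower k K M]
    (hreg : ∀ x : K, IsAlgebraic k x → x ∈ (algebraMap k K).range)
    [FiniteDimensional K M] [IsGalois K M] (U : Subgroup (M ≃ₐ[K] M)) :
    U ⊔ algebraicFixer k K M = ⊤ ↔
      ∀ x : M, ((∀ u ∈ U, u x = x) ∧ IsAlgebraic k x) ↔ x ∈ (algebraMap k M).range := by
  constructor
  · refine fun h x => ⟨fun ⟨hU, hx⟩ => ?_, ?_⟩
    · have hle : U ⊔ algebraicFixer k K M ≤ MulAction.stabilizer (M ≃ₐ[K] M) x :=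
        sup_le (fun u hu => hU u hu) fun g hg => hg x hx
      obtain ⟨y, rfl⟩ := (IsGalois.mem_range_algebraMap_iff_fixed x).2 fun g =>
        hle (h ▸ Subgroup.mem_top g)
      obtain ⟨z, rfl⟩ := hreg y ((isAlgebraic_algebraMap_iff (algebraMap K M).injective).1 hx)
      exact ⟨z, IsScalarTower.algebraMap_apply k K M z⟩
    · rintro ⟨z, rfl⟩
      exact ⟨fun u _ => (u.restrictScalars k).commutes z, isAlgebraic_algebraMap z⟩
  · refine fun h => eq_top_iff.2 fun g _ => ?_
    let := algebraicClosureAction (k := k) U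
    let f : algebraicClosure k M ≃ₐ[FixedPoints.subfield U (algebraicClosure k M)]
        algebraicClosure k M := AlgEquiv.ofRingEquiv
      (f := (algebraicClosure.algEquivOfAlgEquiv (g.restrictScalars k)).toRingEquiv) (by
        rintro ⟨x, hx⟩
        obtain ⟨z, hz⟩ := (h x).1 ⟨fun u hu => congrArg Subtype.val (hx ⟨u, hu⟩),
          mem_algebraicClosure_iff.1 x.2⟩
        refine Subtype.ext ?_
        change g x = x
        rw [← hz]
        exact (g.restrictScalars k).commutes z)
    obtain ⟨u, hu⟩ := FixedPoints.toAlgAut_surjective U (algebraicClosure k M) f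
    rw [← mul_inv_cancel_left u.1 g]
    refine mul_mem (Subgroup.mem_sup_left u.2) (Subgroup.mem_sup_right fun x hx => ?_)
    have hgu : u.1 x = g x :=
      congrArg Subtype.val (DFunLike.congr_fun hu
        (⟨x, mem_algebraicClosure_iff.2 hx⟩ : algebraicClosure k M))
    rw [AlgEquiv.mul_apply, ← hgu]
    exact u.1.symm_apply_apply x

theorem forall_mem_closure_range_apply_eq {F E ι : Type*} [Field F] [Field E] [Algebra F E]
    (τ : ι → (E ≃ₐ[F] E)) (x : E) :
    (∀ u ∈ Subgroup.closure (Set.range τ), u x = x) ↔ ∀ i, τ i x = x := by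
  refine ⟨fun h i => h _ (Subgroup.subset_closure ⟨i, rfl⟩), fun h => ?_⟩
  have hle : Subgroup.closure (Set.range τ) ≤ MulAction.stabilizer (E ≃ₐ[F] E) x := by
    rw [Subgroup.closure_le]
    rintro _ ⟨i, rfl⟩
    exact h i
  exact fun u hu => hle hu

/-- The elements fixed by a lift of `σ` and by `Gal(M/L)` are the elements of `L` fixed by `σ`. -/
theorem forall_mem_sup_ker_restrictNormalHom {K M ι : Type*} [Field K] [Field M] [Algebra K M]
    [FiniteDimensional K M] [IsGalois K M] (L : IntermediateField K M) [IsGalois K L]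
    (τ : ι → (M ≃ₐ[K] M)) (x : M) :
    (∀ u ∈ Subgroup.closure (Set.range τ) ⊔ (AlgEquiv.restrictNormalHom L).ker, u x = x) ↔
      ∃ y : L, (∀ i, AlgEquiv.restrictNormalHom L (τ i) y = y) ∧ (y : M) = x := by
  rw [IntermediateField.restrictNormalHom_ker]
  simp only [Subtype.ext_iff, AlgEquiv.restrictNormalHom_apply]
  constructor
  · intro h
    have hx : x ∈ L := by
      rw [← IsGalois.fixedField_fixingSubgroup L]
      exact fun g => h g.1 (Subgroup.mem_sup_right g.2)
    exact ⟨⟨x, hx⟩, fun i => h _ (Subgroup.mem_sup_left (Subgroup.subset_closure ⟨i, rfl⟩)), rfl⟩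
  · rintro ⟨y, hy, rfl⟩
    have hle : Subgroup.closure (Set.range τ) ⊔ L.fixingSubgroup ≤
        MulAction.stabilizer (M ≃ₐ[K] M) (y : M) :=
      sup_le (fun u hu => (forall_mem_closure_range_apply_eq τ (y : M)).2 hy u hu)
        fun g hg => hg y
    exact fun u hu => hle hu

theorem closure_sup_algebraicFixer_eq_top_iff {k K M ι : Type*} [Field k] [Field K] [Field M]
    [Algebra k K] [Algebra K M] [Algebra k M] [IsScalarTower k K M]
    (hreg : ∀ x : K, IsAlgebraic k x → x ∈ (algebraMap k K).range)
    [FiniteDimensional K M] [IsGalois K M] (τ : ι → (M ≃ₐ[K] M)) :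
    Subgroup.closure (Set.range τ) ⊔ algebraicFixer k K M = ⊤ ↔
      ∀ x : M, ((∀ i, τ i x = x) ∧ IsAlgebraic k x) ↔ x ∈ (algebraMap k M).range := by
  simp only [sup_algebraicFixer_eq_top_iff hreg, forall_mem_closure_range_apply_eq]

theorem closure_sup_map_algebraicFixer_eq_top_iff {k K M ι : Type*}
    [Field k] [Field K] [Field M]
    [Algebra k K] [Algebra K M] [Algebra k M] [IsScalarTower k K M]
    (hreg : ∀ x : K, IsAlgebraic k x → x ∈ (algebraMap k K).range)
    [FiniteDimensional K M] [IsGalois K M] (L : IntermediateField K M) [IsGalois K L]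
    (σ : ι → (L ≃ₐ[K] L)) :
    Subgroup.closure (Set.range σ) ⊔
        (algebraicFixer k K M).map (AlgEquiv.restrictNormalHom L) = ⊤ ↔
      ∀ x : L, ((∀ i, σ i x = x) ∧ IsAlgebraic k (x : M)) ↔
        (x : M) ∈ (algebraMap k M).range := by
  have hsurj := AlgEquiv.restrictNormalHom_surjective (F := K) (K₁ := L) M
  obtain ⟨τ, hτ⟩ := hsurj.comp_left σ
  obtain rfl : (fun i => AlgEquiv.restrictNormalHom L (τ i)) = σ := hτ
  rw [← map_closure_range_sup, ← Subgroup.map_top_of_surjective _ hsurj, Subgroup.map_eq_map_iff,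
    top_sup_eq, sup_right_comm, sup_algebraicFixer_eq_top_iff hreg]
  simp only [forall_mem_sup_ker_restrictNormalHom]
  constructor
  · intro h x
    rw [← h x]
    simp
  · intro h x
    constructor
    · rintro ⟨⟨y, hy, rfl⟩, hx⟩
      exact (h y).1 ⟨hy, hx⟩
    · rintro ⟨z, rfl⟩
      have hz : algebraMap k M z ∈ L := by
        rw [IsScalarTower.algebraMap_apply k K M]
        exact L.algebraMap_mem _
      have := (h ⟨_, hz⟩).2 ⟨z, rfl⟩
      exact ⟨⟨_, this.1, rfl⟩, this.2⟩

theorem fixTuple_inf_eq_lift {K M : Type*} [Field K] [Field M] [Algebra K M]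
    (L : IntermediateField K M) [Normal K L] {e : ℕ} (τ : Fin e → (M ≃ₐ[K] M)) :
    fixTuple τ ⊓ L =
      IntermediateField.lift (fixTuple fun i => AlgEquiv.restrictNormalHom L (τ i)) := by
  ext x
  by_cases hx : x ∈ L
  · rw [show x = ((⟨x, hx⟩ : L) : M) from rfl, IntermediateField.mem_lift]
    change (∀ i, τ i x = x) ∧ x ∈ L ↔
      ∀ i, AlgEquiv.restrictNormalHom L (τ i) ⟨x, hx⟩ = ⟨x, hx⟩
    simp [hx, Subtype.ext_iff, AlgEquiv.restrictNormalHom_apply]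
  · exact iff_of_false (fun h => hx h.2) fun h => hx (IntermediateField.lift_le _ h)

/-- If `k` is relatively algebraically closed in a field `K'` isomorphic to `Fix(σ̄)`, then it is so
in `Fix(σ̄)`. -/
theorem isAlgebraic_fixTuple_iff {k K M : Type*} [Field k] [Field K] [Field M]
    [Algebra k K] [Algebra K M] [Algebra k M] [IsScalarTower k K M] {e : ℕ}
    {L K' : IntermediateField K M}
    (hK'reg : ∀ x : K', IsAlgebraic k (x : M) → (x : M) ∈ (algebraMap k M).range)
    (σ : Fin e → (L ≃ₐ[K] L)) (φ : ↥(fixTuple σ) ≃ₐ[K] K') (x : L) :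
    ((∀ i, σ i x = x) ∧ IsAlgebraic k (x : M)) ↔ (x : M) ∈ (algebraMap k M).range := by
  constructor
  · rintro ⟨hx, halg⟩
    have h₁ : IsAlgebraic k (⟨x, hx⟩ : fixTuple σ) :=
      (isAlgebraic_algHom_iff ((L.val.comp (fixTuple σ).val).restrictScalars k)
        (L.val.comp (fixTuple σ).val).injective).1 halg
    have h₂ := IsAlgebraic.algHom ((K'.val.comp φ.toAlgHom).restrictScalars k) h₁
    obtain ⟨z, hz⟩ := hK'reg _ h₂
    refine ⟨z, ?_⟩
    have h₃ : φ (algebraMap k (fixTuple σ) z) = φ ⟨x, hx⟩ := by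
      refine Subtype.ext (Eq.trans ?_ hz)
      exact ((K'.val.comp φ.toAlgHom).restrictScalars k).commutes z
    exact congrArg (fun y : fixTuple σ => ((y : L) : M)) (φ.injective h₃)
  · rintro ⟨z, hz⟩
    refine ⟨fun i => ?_, hz ▸ isAlgebraic_algebraMap z⟩
    obtain rfl : algebraMap k L z = x := Subtype.ext hz
    exact ((σ i).restrictScalars k).commutes z

/-- Independence of the measure from the chosen Galois extension: with `k` perfect
and relatively algebraically closed in `K`, `M/K` finite Galois, `L` an
intermediate field of `M/K` Galois over `K`, `Gal(k_M/k)` generated by `e`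
elements, and `K'` an intermediate field of `L/K` in which `k` is relatively
algebraically closed, one has
`|{σ̄ ∈ Gal(L/K)^e : Fix(σ̄) ≅_K K'}| · |{τ̄ ∈ Gal(M/K)^e : Fix(τ̄) ∩ k_M = k}|`
`= |{τ̄ ∈ Gal(M/K)^e : Fix(τ̄) ∩ k_M = k ∧ Fix(τ̄) ∩ L ≅_K K'}| · |{σ̄ ∈ Gal(L/K)^e : Fix(σ̄) ∩ k_L = k}|`. -/
theorem stmt_4 (k K M : Type*) [Field k] [Field K] [Field M]
    [Algebra k K] [Algebra K M] [Algebra k M] [IsScalarTower k K M]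
    [PerfectField k]
    (hreg : ∀ x : K, IsAlgebraic k x → x ∈ (algebraMap k K).range)
    (e : ℕ) (he : 1 ≤ e)
    [FiniteDimensional K M] [IsGalois K M]
    (L : IntermediateField K M) [IsGalois K L]
    (hgenM : ∃ ρ : Fin e → (algebraicClosure k M ≃ₐ[k] algebraicClosure k M),
      Subgroup.closure (Set.range ρ) = ⊤)
    (K' : IntermediateField K M) (hK'L : K' ≤ L)
    (hK'reg : ∀ x : K', IsAlgebraic k (x : M) → (x : M) ∈ (algebraMap k M).range) :
    Nat.card {σ : Fin e → (L ≃ₐ[K] L) // Nonempty (↥(fixTuple σ) ≃ₐ[K] K')}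
      * Nat.card {τ : Fin e → (M ≃ₐ[K] M) //
          ∀ x : M, ((∀ i, τ i x = x) ∧ IsAlgebraic k x) ↔ x ∈ (algebraMap k M).range}
      = Nat.card {τ : Fin e → (M ≃ₐ[K] M) //
          (∀ x : M, ((∀ i, τ i x = x) ∧ IsAlgebraic k x) ↔ x ∈ (algebraMap k M).range) ∧
          Nonempty (↥(fixTuple τ ⊓ L) ≃ₐ[K] K')}
        * Nat.card {σ : Fin e → (L ≃ₐ[K] L) //
            ∀ x : L, ((∀ i, σ i x = x) ∧ IsAlgebraic k (x : M)) ↔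
              (x : M) ∈ (algebraMap k M).range} := by

  let π := AlgEquiv.restrictNormalHom (F := K) (K₁ := M) L
  simp_rw [← closure_sup_algebraicFixer_eq_top_iff hreg,
    ← closure_sup_map_algebraicFixer_eq_top_iff hreg L]
  have hiso (τ : Fin e → (M ≃ₐ[K] M)) : Nonempty (↥(fixTuple τ ⊓ L) ≃ₐ[K] K') ↔
      Nonempty (↥(fixTuple fun i => π (τ i)) ≃ₐ[K] K') := by
    rw [fixTuple_inf_eq_lift]
    exact ⟨fun ⟨φ⟩ => ⟨(IntermediateField.liftAlgEquiv _).trans φ⟩,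
      fun ⟨φ⟩ => ⟨(IntermediateField.liftAlgEquiv _).symm.trans φ⟩⟩
  simp_rw [hiso]
  exact card_mul_card_eq_card_mul_card
    (AlgEquiv.restrictNormalHom_surjective (F := K) (K₁ := L) M) (algebraicFixer k K M)
    (fun σ => Nonempty (↥(fixTuple σ) ≃ₐ[K] K')) fun σ ⟨φ⟩ =>
      (closure_sup_map_algebraicFixer_eq_top_iff hreg L σ).2
        (isAlgebraic_fixTuple_iff hK'reg σ φ)
end

section
/- Let G be a group and 𝒜 a collection of subsets of G containing G and closed under complements, finite unions, finite intersections, and left translations (if X ∈ 𝒜 and g ∈ G then gX ∈ 𝒜). Let H ∈ 𝒜 be a subgroup of G of finite index. Suppose there is a function μ_H, defined on those X ∈ 𝒜 with X ⊆ H and taking values in the nonnegative reals, such that μ_H(H) = 1, μ_H(X ∪ Y) = μ_H(X) + μ_H(Y) whenever X, Y ∈ 𝒜 are disjoint subsets of H, and μ_H(hX) = μ_H(X) for all h ∈ H and all X ∈ 𝒜 with X ⊆ H. Then there exists a function μ_G : 𝒜 → ℝ with nonnegative values such that μ_G(G) = 1, μ_G(X ∪ Y) = μ_G(X) + μ_G(Y)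 for disjoint X, Y ∈ 𝒜, and μ_G(gX) = μ_G(X) for all g ∈ G and X ∈ 𝒜. -/
open Pointwise

/-- Definable amenability passes from a finite-index subgroup to the group:
if `𝒜` is an algebra of subsets of a group `G` closed under left translations,
`H ∈ 𝒜` is a subgroup of finite index, and there is a left `H`-invariant finitely
additive probability measure on the members of `𝒜` contained in `H`, then there
is a left `G`-invariant finitely additive probability measure on `𝒜`. -/
theorem stmt_6 {G : Type*} [Group G] (𝒜 : Set (Set G))
    (huniv : Set.univ ∈ 𝒜)
    (hcompl : ∀ X ∈ 𝒜, Xᶜ ∈ 𝒜)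
    (hunion : ∀ X ∈ 𝒜, ∀ Y ∈ 𝒜, X ∪ Y ∈ 𝒜)
    (hinter : ∀ X ∈ 𝒜, ∀ Y ∈ 𝒜, X ∩ Y ∈ 𝒜)
    (htrans : ∀ X ∈ 𝒜, ∀ g : G, g • X ∈ 𝒜)
    (H : Subgroup G) (hH : (H : Set G) ∈ 𝒜) (hfin : H.index ≠ 0)
    (μH : Set G → ℝ)
    (hμH0 : ∀ X ∈ 𝒜, X ⊆ (H : Set G) → 0 ≤ μH X)
    (hμH1 : μH (H : Set G) = 1)
    (hμHadd : ∀ X ∈ 𝒜, ∀ Y ∈ 𝒜, X ⊆ (H : Set G) → Y ⊆ (H : Set G) →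
      Disjoint X Y → μH (X ∪ Y) = μH X + μH Y)
    (hμHinv : ∀ h ∈ H, ∀ X ∈ 𝒜, X ⊆ (H : Set G) → μH (h • X) = μH X) :
    ∃ μG : Set G → ℝ,
      (∀ X ∈ 𝒜, 0 ≤ μG X) ∧
      μG Set.univ = 1 ∧
      (∀ X ∈ 𝒜, ∀ Y ∈ 𝒜, Disjoint X Y → μG (X ∪ Y) = μG X + μG Y) ∧
      (∀ g : G, ∀ X ∈ 𝒜, μG (g • X) = μG X) := by
  have : H.FiniteIndex := ⟨hfin⟩
  have : Fintype (G ⧸ H) := Fintype.ofFinite _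
  have hmem : ∀ X ∈ 𝒜, ∀ a : G, a⁻¹ • X ∩ (H : Set G) ∈ 𝒜 := fun X hX a =>
    hinter _ (htrans X hX _) _ hH
  have hcoset : ∀ X ∈ 𝒜, ∀ a b : G, (a : G ⧸ H) = b →
      μH (a⁻¹ • X ∩ H) = μH (b⁻¹ • X ∩ H) := by
    intro X hX a b hab
    have hba : b⁻¹ * a ∈ H := QuotientGroup.eq.mp hab.symm
    rw [← hμHinv _ hba _ (hmem X hX a) Set.inter_subset_right, Set.smul_set_inter, smul_smul,
      mul_inv_cancel_right, smul_coe_set hba]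
  refine ⟨fun X => (∑ q : G ⧸ H, μH (q.out⁻¹ • X ∩ H)) / H.index, ?_, ?_, ?_, ?_⟩
  · intro X hX
    exact div_nonneg
      (Finset.sum_nonneg fun q _ => hμH0 _ (hmem X hX _) Set.inter_subset_right)
      (Nat.cast_nonneg _)
  · simp only [Set.smul_set_univ, Set.univ_inter, hμH1, Finset.sum_const, Finset.card_univ,
      nsmul_eq_mul, mul_one]
    rw [Subgroup.index_eq_card, Nat.card_eq_fintype_card]
    exact div_self (Nat.cast_ne_zero.mpr Fintype.card_ne_zero)
  · intro X hX Y hY hXY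
    dsimp only
    rw [← add_div, ← Finset.sum_add_distrib]
    congr 1
    refine Finset.sum_congr rfl fun q _ => ?_
    rw [Set.smul_set_union, Set.union_inter_distrib_right]
    exact hμHadd _ (hmem X hX _) _ (hmem Y hY _) Set.inter_subset_right Set.inter_subset_right
      ((Set.disjoint_smul_set.mpr hXY).mono Set.inter_subset_left Set.inter_subset_left)
  · intro g X hX
    dsimp only
    congr 1
    refine Fintype.sum_equiv (MulAction.toPerm g⁻¹) _ _ fun q => ?_
    have hq : q.out⁻¹ • g • X = (g⁻¹ * q.out)⁻¹ • X := by
      rw [smul_smul, mul_inv_rev, inv_inv]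
    rw [hq]
    apply hcoset X hX
    rw [QuotientGroup.out_eq', MulAction.toPerm_apply, ← smul_eq_mul,
      ← MulAction.Quotient.smul_mk, QuotientGroup.out_eq']
end

section
/- Let π : G → H be a surjective group homomorphism with finite kernel of cardinality n. Let 𝒜_G be a collection of subsets of G containing G and closed under complements, finite unions, finite intersections, and left translations by elements of G, and let 𝒜_H be a collection of subsets of H containing H and closed under complements, finite unions, finite intersections, and left translations by elements of H. Assume that for every X ∈ 𝒜_G and every integer i with 1 ≤ i ≤ n, the set (X)_i := {x ∈ X : |X ∩ π⁻¹(π(x))| = i} belongs to 𝒜_G and its image π((X)_i) belongs to 𝒜_H. If there exists a left-invariant finitely additive probability measure on 𝒜_H, then there exists a left-invariant finitely additive probability measure on 𝒜_G. -/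
open Pointwise

/-- A left-invariant finitely additive probability measure (with values in `[0,1]`)
on a translation-closed algebra `𝒜` of subsets of a group `G`. -/
def IsLeftInvariantFAPM {G : Type*} [Group G] (𝒜 : Set (Set G)) (μ : Set G → ℝ) : Prop :=
  (∀ X ∈ 𝒜, 0 ≤ μ X ∧ μ X ≤ 1) ∧
  μ Set.univ = 1 ∧
  (∀ X ∈ 𝒜, ∀ Y ∈ 𝒜, Disjoint X Y → μ (X ∪ Y) = μ X + μ Y) ∧
  (∀ g : G, ∀ X ∈ 𝒜, μ (g • X) = μ X)

/-- If a function takes values in `0, …, n` and its positive level sets lie in a set algebra,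
then so do all its level sets. -/
lemma MeasureTheory.IsSetAlgebra.preimage_singleton_mem_of_pos {H : Type*} {𝒜 : Set (Set H)}
    (h𝒜 : MeasureTheory.IsSetAlgebra 𝒜) {f : H → ℕ} {n : ℕ}
    (hfn : ∀ h, f h ≤ n) (hf : ∀ i, 1 ≤ i → i ≤ n → f ⁻¹' {i} ∈ 𝒜) (i : ℕ) :
    f ⁻¹' {i} ∈ 𝒜 := by
  rcases Nat.eq_zero_or_pos i with rfl | hi
  · have : f ⁻¹' {0} = (⋃ i ∈ Finset.Icc 1 n, f ⁻¹' {i})ᶜ := by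
      ext h
      have := hfn h
      simp only [Set.mem_preimage, Set.mem_singleton_iff, Set.mem_compl_iff, Set.mem_iUnion,
        Finset.mem_Icc, exists_prop, exists_eq_right', not_and, not_le]
      omega
    rw [this]
    refine h𝒜.compl_mem (h𝒜.biUnion_mem _ fun i hi => ?_)
    exact hf i (Finset.mem_Icc.1 hi).1 (Finset.mem_Icc.1 hi).2
  · by_cases hin : i ≤ n
    · exact hf i hi hin
    · have : f ⁻¹' {i} = ∅ := Set.eq_empty_of_forall_notMem fun h hh => hin (hh ▸ hfn h)
      exact this ▸ h𝒜.empty_mem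

namespace IsLeftInvariantFAPM

section Additive

open MeasureTheory Finset

variable {H : Type*} [Group H] {𝒜 : Set (Set H)} {μ : Set H → ℝ}

lemma map_empty (hμ : IsLeftInvariantFAPM 𝒜 μ) (h𝒜 : IsSetAlgebra 𝒜) : μ ∅ = 0 := by
  have h := hμ.2.2.1 ∅ h𝒜.empty_mem ∅ h𝒜.empty_mem (Set.disjoint_empty _)
  rw [Set.union_empty] at h
  linarith

/-- The level sets of a bounded function cut a set into pieces of the same total mass. -/
lemma sum_inter_preimage (hμ : IsLeftInvariantFAPM 𝒜 μ) (h𝒜 : IsSetAlgebra 𝒜)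
    {f : H → ℕ} {N : ℕ} (hfN : ∀ x, f x < N) (hf : ∀ i, f ⁻¹' {i} ∈ 𝒜)
    {B : Set H} (hB : B ∈ 𝒜) : ∑ i ∈ range N, μ (B ∩ f ⁻¹' {i}) = μ B := by
  have key : ∀ m, B ∩ f ⁻¹' Set.Iio m ∈ 𝒜 ∧
      ∑ i ∈ range m, μ (B ∩ f ⁻¹' {i}) = μ (B ∩ f ⁻¹' Set.Iio m) := by
    intro m
    induction m with
    | zero => simp [h𝒜.empty_mem, hμ.map_empty h𝒜]
    | succ m ih =>
      have hsplit : B ∩ f ⁻¹' Set.Iio (m + 1) = (B ∩ f ⁻¹' Set.Iio m) ∪ (B ∩ f ⁻¹' {m}) := by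
        rw [← Set.inter_union_distrib_left, ← Set.preimage_union]
        congr 2
        ext k
        simp
      have hm := h𝒜.inter_mem hB (hf m)
      refine ⟨hsplit ▸ h𝒜.union_mem ih.1 hm, ?_⟩
      rw [sum_range_succ, ih.2, hsplit, hμ.2.2.1 _ ih.1 _ hm]
      refine Set.disjoint_left.2 fun x hx hx' => ?_
      exact (ne_of_lt hx.2) hx'.2
  rw [(key N).2, Set.inter_eq_left.2 (show B ⊆ f ⁻¹' Set.Iio N from fun x _ => hfN x)]

/-- Additivity of the integral of bounded natural-valued functions. -/
lemma sum_mul_preimage_add (hμ : IsLeftInvariantFAPM 𝒜 μ) (h𝒜 : IsSetAlgebra 𝒜)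
    {f g : H → ℕ} {N : ℕ} (hfN : ∀ x, f x < N) (hgN : ∀ x, g x < N) (hfgN : ∀ x, (f + g) x < N)
    (hf : ∀ i, f ⁻¹' {i} ∈ 𝒜) (hg : ∀ i, g ⁻¹' {i} ∈ 𝒜) (hfg : ∀ i, (f + g) ⁻¹' {i} ∈ 𝒜) :
    ∑ k ∈ range N, (k : ℝ) * μ ((f + g) ⁻¹' {k}) =
      ∑ i ∈ range N, (i : ℝ) * μ (f ⁻¹' {i}) + ∑ j ∈ range N, (j : ℝ) * μ (g ⁻¹' {j}) := by
  let w (i j k : ℕ) : ℝ := μ (f ⁻¹' {i} ∩ g ⁻¹' {j} ∩ (f + g) ⁻¹' {k})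
  have hw (i j k : ℕ) : (k : ℝ) * w i j k = i * w i j k + j * w i j k := by
    by_cases hk : k = i + j
    · subst hk
      push_cast
      ring
    · have : f ⁻¹' {i} ∩ g ⁻¹' {j} ∩ (f + g) ⁻¹' {k} = ∅ := by
        ext x
        simp only [Set.mem_inter_iff, Set.mem_preimage, Set.mem_singleton_iff, Pi.add_apply,
          Set.mem_empty_iff_false, iff_false]
        omega
      simp [w, this, hμ.map_empty h𝒜]
  have hsumf (i : ℕ) : μ (f ⁻¹' {i}) = ∑ j ∈ range N, ∑ k ∈ range N, w i j k := by
    rw [← hμ.sum_inter_preimage h𝒜 hgN hg (hf i)]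
    exact sum_congr rfl fun j _ =>
      (hμ.sum_inter_preimage h𝒜 hfgN hfg (h𝒜.inter_mem (hf i) (hg j))).symm
  have hsumg (j : ℕ) : μ (g ⁻¹' {j}) = ∑ i ∈ range N, ∑ k ∈ range N, w i j k := by
    rw [← hμ.sum_inter_preimage h𝒜 hfN hf (hg j)]
    refine sum_congr rfl fun i _ => ?_
    rw [Set.inter_comm]
    exact (hμ.sum_inter_preimage h𝒜 hfgN hfg (h𝒜.inter_mem (hf i) (hg j))).symm
  have hsumfg (k : ℕ) : μ ((f + g) ⁻¹' {k}) = ∑ i ∈ range N, ∑ j ∈ range N, w i j k := by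
    rw [← hμ.sum_inter_preimage h𝒜 hfN hf (hfg k)]
    refine sum_congr rfl fun i _ => ?_
    rw [← hμ.sum_inter_preimage h𝒜 hgN hg (h𝒜.inter_mem (hfg k) (hf i))]
    refine sum_congr rfl fun j _ => ?_
    rw [Set.inter_assoc, Set.inter_comm]
  have hg' : ∑ j ∈ range N, (j : ℝ) * μ (g ⁻¹' {j}) =
      ∑ i ∈ range N, ∑ j ∈ range N, ∑ k ∈ range N, j * w i j k := by
    simp_rw [hsumg, mul_sum]
    exact sum_comm
  have hfg' : ∑ k ∈ range N, (k : ℝ) * μ ((f + g) ⁻¹' {k}) =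
      ∑ i ∈ range N, ∑ j ∈ range N, ∑ k ∈ range N, k * w i j k := by
    simp_rw [hsumfg, mul_sum]
    rw [sum_comm]
    exact sum_congr rfl fun i _ => sum_comm
  rw [hfg', hg']
  simp_rw [hsumf, mul_sum, hw, sum_add_distrib]

end Additive

end IsLeftInvariantFAPM

namespace MonoidHom

variable {G H : Type*} [Group G] [Group H] (π : G →* H)

/-- The number of points of `X` in the fibre of `π` over `h`. -/
noncomputable def fiberCount (X : Set G) (h : H) : ℕ := (X ∩ π ⁻¹' {h}).ncard

lemma preimage_singleton_eq_smul_ker (x : G) : π ⁻¹' {π x} = x • (π.ker : Set G) := by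
  ext y
  rw [Set.mem_smul_set_iff_inv_smul_mem]
  simp [MonoidHom.mem_ker, inv_mul_eq_one, eq_comm (a := π y)]

variable {π}

lemma finite_preimage_singleton (hsurj : Function.Surjective π)
    (hfin : (π.ker : Set G).Finite) (h : H) : (π ⁻¹' {h}).Finite := by
  obtain ⟨x, rfl⟩ := hsurj h
  rw [preimage_singleton_eq_smul_ker]
  exact hfin.smul_set

lemma fiberCount_univ (hsurj : Function.Surjective π) (h : H) :
    π.fiberCount Set.univ h = Nat.card π.ker := by
  obtain ⟨x, rfl⟩ := hsurj h
  rw [fiberCount, Set.univ_inter, preimage_singleton_eq_smul_ker, Set.ncard_smul_set]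
  rfl

lemma fiberCount_le (hsurj : Function.Surjective π) (hfin : (π.ker : Set G).Finite)
    (X : Set G) (h : H) : π.fiberCount X h ≤ Nat.card π.ker := by
  rw [← fiberCount_univ hsurj h]
  exact Set.ncard_le_ncard (Set.inter_subset_inter_left _ (Set.subset_univ X))
    ((finite_preimage_singleton hsurj hfin h).inter_of_right _)

lemma fiberCount_union (hsurj : Function.Surjective π) (hfin : (π.ker : Set G).Finite)
    {X Y : Set G} (hXY : Disjoint X Y) :
    π.fiberCount (X ∪ Y) = π.fiberCount X + π.fiberCount Y := by
  ext h
  have hh := finite_preimage_singleton hsurj hfin h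
  rw [Pi.add_apply, fiberCount, Set.union_inter_distrib_right]
  exact Set.ncard_union_eq (hXY.mono Set.inter_subset_left Set.inter_subset_left)
    (hh.inter_of_right _) (hh.inter_of_right _)

lemma fiberCount_smul (g : G) (X : Set G) (h : H) :
    π.fiberCount (g • X) h = π.fiberCount X ((π g)⁻¹ * h) := by
  have : g • X ∩ π ⁻¹' {h} = g • (X ∩ π ⁻¹' {(π g)⁻¹ * h}) := by
    rw [Set.smul_set_inter]
    congr 1
    ext y
    simp [Set.mem_smul_set_iff_inv_smul_mem]
  rw [fiberCount, this, Set.ncard_smul_set, fiberCount]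

lemma preimage_fiberCount_smul (g : G) (X : Set G) (s : Set ℕ) :
    π.fiberCount (g • X) ⁻¹' s = π g • (π.fiberCount X ⁻¹' s) := by
  ext h
  simp [Set.mem_smul_set_iff_inv_smul_mem, fiberCount_smul]

lemma preimage_fiberCount_eq_image (X : Set G) {i : ℕ} (hi : i ≠ 0) :
    π.fiberCount X ⁻¹' {i} = π '' {x ∈ X | (X ∩ π ⁻¹' {π x}).ncard = i} := by
  ext h
  constructor
  · intro hh
    obtain ⟨x, hxX, hx⟩ := Set.nonempty_of_ncard_ne_zero (ne_of_eq_of_ne hh hi)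
    obtain rfl : π x = h := hx
    exact ⟨x, ⟨hxX, hh⟩, rfl⟩
  · rintro ⟨x, ⟨-, hx⟩, rfl⟩
    exact hx

end MonoidHom

/-- Definable amenability passes along a surjection with finite kernel: if
`π : G → H` is a surjective homomorphism with finite kernel of cardinality `n`,
`𝒜_G`, `𝒜_H` are translation-closed algebras of subsets of `G` and `H`, such that
for `X ∈ 𝒜_G` the pieces `(X)_i = {x ∈ X : |X ∩ π⁻¹(π x)| = i}` lie in `𝒜_G` and
their images in `𝒜_H`, then a left-invariant finitely additive probability measure
on `𝒜_H` yields one on `𝒜_G`. -/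
theorem stmt_7 {G H : Type*} [Group G] [Group H]
    (π : G →* H) (hsurj : Function.Surjective π)
    (n : ℕ) (hn : 0 < n) (hker : Nat.card π.ker = n) (hkerfin : (π.ker : Set G).Finite)
    (𝒜G : Set (Set G)) (𝒜H : Set (Set H))
    (hGuniv : Set.univ ∈ 𝒜G)
    (hGcompl : ∀ X ∈ 𝒜G, Xᶜ ∈ 𝒜G)
    (hGunion : ∀ X ∈ 𝒜G, ∀ Y ∈ 𝒜G, X ∪ Y ∈ 𝒜G)
    (hGinter : ∀ X ∈ 𝒜G, ∀ Y ∈ 𝒜G, X ∩ Y ∈ 𝒜G)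
    (hGtrans : ∀ X ∈ 𝒜G, ∀ g : G, g • X ∈ 𝒜G)
    (hHuniv : Set.univ ∈ 𝒜H)
    (hHcompl : ∀ X ∈ 𝒜H, Xᶜ ∈ 𝒜H)
    (hHunion : ∀ X ∈ 𝒜H, ∀ Y ∈ 𝒜H, X ∪ Y ∈ 𝒜H)
    (hHinter : ∀ X ∈ 𝒜H, ∀ Y ∈ 𝒜H, X ∩ Y ∈ 𝒜H)
    (hHtrans : ∀ X ∈ 𝒜H, ∀ h : H, h • X ∈ 𝒜H)
    (hpieces : ∀ X ∈ 𝒜G, ∀ i : ℕ, 1 ≤ i → i ≤ n →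
      {x ∈ X | (X ∩ π ⁻¹' {π x}).ncard = i} ∈ 𝒜G ∧
      π '' {x ∈ X | (X ∩ π ⁻¹' {π x}).ncard = i} ∈ 𝒜H)
    (hH : ∃ μH : Set H → ℝ, IsLeftInvariantFAPM 𝒜H μH) :
    ∃ μG : Set G → ℝ, IsLeftInvariantFAPM 𝒜G μG := by
  obtain ⟨μ, hμ⟩ := hH
  have h𝒜 : MeasureTheory.IsSetAlgebra 𝒜H :=
    { empty_mem := by simpa using hHcompl _ hHuniv
      compl_mem := fun X hX => hHcompl X hX
      union_mem := fun X Y hX hY => hHunion X hX Y hY }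
  have hn' : (0 : ℝ) < n := Nat.cast_pos.2 hn
  have hle (X : Set G) (h : H) : π.fiberCount X h ≤ n :=
    hker ▸ MonoidHom.fiberCount_le hsurj hkerfin X h
  have hlt (X : Set G) (h : H) : π.fiberCount X h < n + 1 := Nat.lt_succ_of_le (hle X h)
  have hlevel (X : Set G) (hX : X ∈ 𝒜G) (i : ℕ) : π.fiberCount X ⁻¹' {i} ∈ 𝒜H := by
    refine h𝒜.preimage_singleton_mem_of_pos (hle X) (fun i hi hin => ?_) i
    rw [MonoidHom.preimage_fiberCount_eq_image X (by omega)]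
    exact (hpieces X hX i hi hin).2
  refine ⟨fun X => (∑ i ∈ Finset.range (n + 1), (i : ℝ) * μ (π.fiberCount X ⁻¹' {i})) / n,
    fun X hX => ⟨?_, ?_⟩, ?_, fun X hX Y hY hXY => ?_, fun g X hX => ?_⟩
  · exact div_nonneg (Finset.sum_nonneg fun i _ =>
      mul_nonneg i.cast_nonneg (hμ.1 _ (hlevel X hX i)).1) hn'.le
  · rw [div_le_one hn']
    calc ∑ i ∈ Finset.range (n + 1), (i : ℝ) * μ (π.fiberCount X ⁻¹' {i})
        ≤ ∑ i ∈ Finset.range (n + 1), (n : ℝ) * μ (Set.univ ∩ π.fiberCount X ⁻¹' {i}) := by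
          refine Finset.sum_le_sum fun i hi => ?_
          rw [Set.univ_inter]
          exact mul_le_mul_of_nonneg_right
            (Nat.cast_le.2 (Nat.lt_succ_iff.1 (Finset.mem_range.1 hi))) (hμ.1 _ (hlevel X hX i)).1
      _ = n := by
          rw [← Finset.mul_sum, hμ.sum_inter_preimage h𝒜 (hlt X) (hlevel X hX) hHuniv, hμ.2.1,
            mul_one]
  · have huniv : π.fiberCount Set.univ = fun _ => n :=
      funext fun h => (MonoidHom.fiberCount_univ hsurj h).trans hker
    dsimp only
    rw [huniv, Finset.sum_eq_single_of_mem n (Finset.self_mem_range_succ n),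
      Set.preimage_const_of_mem (Set.mem_singleton n), hμ.2.1, mul_one, div_self hn'.ne']
    intro i _ hi
    rw [Set.preimage_const_of_notMem (fun h => hi h.symm), hμ.map_empty h𝒜, mul_zero]
  · have hunion := MonoidHom.fiberCount_union hsurj hkerfin hXY
    dsimp only
    rw [← add_div, hunion, hμ.sum_mul_preimage_add h𝒜 (hlt X) (hlt Y) (hunion ▸ hlt _)
      (hlevel X hX) (hlevel Y hY) (hunion ▸ hlevel _ (hGunion X hX Y hY))]
  · dsimp only
    simp_rw [MonoidHom.preimage_fiberCount_smul, hμ.2.2.2 (π g) _ (hlevel X hX _)]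
end

section
/- Let k be a perfect field and F a field extension of k in which k is relatively algebraically closed (every element of F algebraic over k lies in k). Fix an algebraic closure F̄ of F and let k̄ denote the algebraic closure of k inside F̄. Then every k-automorphism σ of F extends to a field automorphism σ̃ of F̄ such that σ̃(x) = x for every x ∈ k̄. -/
open Polynomial TensorProduct

section RelativelyAlgebraicallyClosed

variable {k F E : Type*} [Field k] [Field F] [Field E]
  [Algebra k F] [Algebra F E] [Algebra k E] [IsScalarTower k F E]

/-- If `k` is relatively algebraically closed in `F`, then the minimal polynomial over `k` of an
element integral over `k` stays minimal over `F`. -/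
theorem minpoly_map_of_relatively_algebraically_closed
    (hreg : ∀ x : F, IsAlgebraic k x → x ∈ (algebraMap k F).range) {a : E} (ha : IsIntegral k a) :
    (minpoly k a).map (algebraMap k F) = minpoly F a := by
  refine minpoly.map_algebraMap ha ?_
  have h := integralClosure.mem_lifts_of_monic_of_dvd_map F (minpoly.monic ha)
    (minpoly.monic ha.tower_top) (minpoly.dvd_map_of_isScalarTower k F a)
  rw [lifts_iff_coeff_lifts] at h ⊢
  intro n
  obtain ⟨c, hc⟩ := h n
  rw [← hc]
  exact hreg _ c.2.isAlgebraic

/-- If `k` is relatively algebraically closed in `F`, then simple integral extensions of `k` are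
linearly disjoint from `F`. -/
theorem adjoin_simple_linearDisjoint_of_relatively_algebraically_closed
    (hreg : ∀ x : F, IsAlgebraic k x → x ∈ (algebraMap k F).range) {a : E} (ha : IsIntegral k a) :
    (IntermediateField.adjoin k {a}).LinearDisjoint F := by
  have hdeg : (minpoly k a).natDegree = (minpoly F a).natDegree := by
    rw [← minpoly_map_of_relatively_algebraically_closed hreg ha, natDegree_map]
  refine .of_basis_left (IntermediateField.adjoin.powerBasis ha).basis ?_
  convert (linearIndependent_pow (K := F) a).comp _ (Fin.cast_injective
    ((IntermediateField.adjoin.powerBasis_dim ha).trans hdeg))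
  funext i
  simp [IntermediateField.adjoin.powerBasis_gen]

/-- If the perfect field `k` is relatively algebraically closed in `F`, then every algebraic
extension of `k` is linearly disjoint from `F`. -/
theorem linearDisjoint_of_relatively_algebraically_closed [PerfectField k]
    (hreg : ∀ x : F, IsAlgebraic k x → x ∈ (algebraMap k F).range)
    (A : IntermediateField k E) [Algebra.IsAlgebraic k A] : A.LinearDisjoint F := by
  refine Submodule.LinearDisjoint.of_linearDisjoint_fg_left _ _ fun M hM ⟨s, hs⟩ ↦ ?_
  have hint : ∀ x ∈ (s : Set E), IsIntegral k x := fun x hx ↦ by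
    have hxA : x ∈ A := hM (hs ▸ Submodule.subset_span hx)
    exact (isAlgebraic_algebraMap_iff (algebraMap A E).injective).mpr
      (Algebra.IsAlgebraic.isAlgebraic (R := k) (⟨x, hxA⟩ : A)) |>.isIntegral
  let L := IntermediateField.adjoin k (s : Set E)
  have : FiniteDimensional k L := IntermediateField.finiteDimensional_adjoin hint
  obtain ⟨a, ha⟩ := Field.exists_primitive_element k L
  have haL : IntermediateField.adjoin k {(a : E)} = L := by
    have := congrArg IntermediateField.lift ha
    rwa [IntermediateField.lift_adjoin_simple, IntermediateField.lift_top] at this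
  have hL : L.LinearDisjoint F := haL ▸
    adjoin_simple_linearDisjoint_of_relatively_algebraically_closed hreg
      ((Algebra.IsIntegral.isIntegral (R := k) a).map L.val)
  refine Submodule.LinearDisjoint.of_le_left_of_flat hL ?_
  rw [← hs, Submodule.span_le]
  exact IntermediateField.subset_adjoin k _

end RelativelyAlgebraicallyClosed

/-- An automorphism of a field `T` extends along any embedding of `T` into an algebraically closed
field that is algebraic over the image of `T`. -/
theorem exists_ringEquiv_comp_eq_of_isField {T E : Type*} [CommRing T] [Field E] [IsAlgClosed E]
    (hT : IsField T) (φ : T →+* E) (hφ : φ.IsIntegral) (τ : T ≃+* T) :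
    ∃ e : E ≃+* E, ∀ t, e (φ t) = φ (τ t) := by
  let := hT.toField
  let := φ.toAlgebra
  have : Algebra.IsIntegral T E := ⟨hφ⟩
  have : IsAlgClosure T E := ⟨inferInstance, inferInstance⟩
  exact ⟨IsAlgClosure.equivOfEquiv E E τ, IsAlgClosure.equivOfEquiv_algebraMap E E τ⟩

/-- Let `k` be a perfect field and `F` an extension of `k` in which `k` is
relatively algebraically closed, let `F̄` be an algebraic closure of `F` and `k̄`
the algebraic closure of `k` inside `F̄`.  Then every `k`-automorphism `σ` of `F`
extends to a field automorphism `σ̃` of `F̄` fixing `k̄` pointwise. -/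
theorem stmt_10 (k F Fbar : Type*) [Field k] [Field F] [Field Fbar]
    [Algebra k F] [Algebra F Fbar] [Algebra k Fbar] [IsScalarTower k F Fbar]
    [PerfectField k] [IsAlgClosure F Fbar]
    (hreg : ∀ x : F, IsAlgebraic k x → x ∈ (algebraMap k F).range)
    (σ : F ≃ₐ[k] F) :
    ∃ σt : Fbar ≃+* Fbar,
      (∀ x : F, σt (algebraMap F Fbar x) = algebraMap F Fbar (σ x)) ∧
      (∀ x : Fbar, IsAlgebraic k x → σt x = x) := by
  let A : IntermediateField k Fbar := algebraicClosure k Fbar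
  have hA : Algebra.IsAlgebraic k A :=
    inferInstanceAs (Algebra.IsAlgebraic k (algebraicClosure k Fbar))
  have hfield : IsField (F ⊗[k] A) :=
    (Algebra.TensorProduct.comm k F A).toMulEquiv.isField
      ((linearDisjoint_of_relatively_algebraically_closed hreg A).isField_of_isAlgebraic (.inl hA))
  let φ : F ⊗[k] A →ₐ[F] Fbar :=
    Algebra.TensorProduct.lift (Algebra.ofId F Fbar) A.val fun _ _ ↦ Commute.all _ _
  have : IsAlgClosed Fbar := IsAlgClosure.isAlgClosed F
  have : Algebra.IsAlgebraic F Fbar := IsAlgClosure.isAlgebraic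
  have hφ : RingHom.IsIntegral (R := F ⊗[k] A) (A := Fbar) φ.toRingHom := by
    refine RingHom.IsIntegral.tower_top (algebraMap F (F ⊗[k] A)) φ.toRingHom ?_
    rw [show φ.toRingHom.comp (algebraMap F (F ⊗[k] A)) = algebraMap F Fbar from
      φ.comp_algebraMap]
    exact algebraMap_isIntegral_iff.mpr inferInstance
  obtain ⟨e, he⟩ := exists_ringEquiv_comp_eq_of_isField (T := F ⊗[k] A) hfield φ.toRingHom hφ
    (Algebra.TensorProduct.congr σ AlgEquiv.refl).toRingEquiv
  have he' (x : F) (a : A) : e (algebraMap F Fbar x * a) = algebraMap F Fbar (σ x) * a := by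
    simpa [φ, Algebra.ofId_apply] using he (x ⊗ₜ a)
  refine ⟨e, fun x ↦ ?_, fun x hx ↦ ?_⟩
  · simpa using he' x 1
  · simpa using he' 1 ⟨x, mem_algebraicClosure_iff.mpr hx⟩
end
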